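/- arXiv:2204.09769 — 3 statements merged into one kernel-verified Lean document; each statement's English description precedes it below -/
import Mathlib

section
/- Let V ⊆ ℝ² be a simple polygon with vertices v₁,…,vₙ listed in counterclockwise order, let φ₁,…,φₙ be harmonic generalized barycentric coordinates on V, and let W ⊆ ℝ² be a convex polygon with vertices w₁,…,wₙ listed in counterclockwise order. Then the harmonic GBC map F(x) = Σᵢ₌₁ⁿ φᵢ(x)·wᵢ is a bijection from V onto W. -/
open Set Filter Topology

/-- The Laplacian `∂²u/∂x² + ∂²u/∂y²` of a function `u : ℝ² → ℝ` at a point `p`. -/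
noncomputable def lap2 (u : ℝ × ℝ → ℝ) (p : ℝ × ℝ) : ℝ :=
  fderiv ℝ (fun q => fderiv ℝ u q (1, 0)) p (1, 0) +
  fderiv ℝ (fun q => fderiv ℝ u q (0, 1)) p (0, 1)

/-- `u` is harmonic on `Ω ⊆ ℝ²`: twice continuously differentiable with vanishing Laplacian. -/
def HarmonicOn2 (u : ℝ × ℝ → ℝ) (Ω : Set (ℝ × ℝ)) : Prop :=
  ContDiffOn ℝ 2 u Ω ∧ ∀ p ∈ Ω, lap2 u p = 0

/-- The 1-periodic loop `γ` winds once counterclockwise around the point `z`: it admits a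
continuous polar-coordinate representation around `z` whose angle increases by `2π`
over one period. -/
def WindsCCWAround (γ : ℝ → ℝ × ℝ) (z : ℝ × ℝ) : Prop :=
  ∃ r θ : ℝ → ℝ, Continuous r ∧ Continuous θ ∧ (∀ t, 0 < r t) ∧
    (∀ t, γ t - z = (r t * Real.cos (θ t), r t * Real.sin (θ t))) ∧
    (∀ t, θ (t + 1) = θ t + 2 * Real.pi)

/-- `γ` is a counterclockwise Jordan parametrization of the boundary of `V`: a 1-periodic
continuous loop, injective on a period, whose image is `frontier V`, and which winds once
counterclockwise around every interior point of `V`. -/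
def IsCCWBoundaryParam (γ : ℝ → ℝ × ℝ) (V : Set (ℝ × ℝ)) : Prop :=
  Continuous γ ∧ (∀ t, γ (t + 1) = γ t) ∧ InjOn γ (Ico (0 : ℝ) 1) ∧
  γ '' Ico (0 : ℝ) 1 = frontier V ∧ ∀ z ∈ interior V, WindsCCWAround γ z

/-- `γ` is a counterclockwise piecewise-linear parametrization of the boundary of `V`
through the vertices `v 0, …, v (n-1)` (the vertex list `v` is read cyclically). -/
def IsPolygonalCCWParam (γ : ℝ → ℝ × ℝ) (n : ℕ) (v : ℕ → ℝ × ℝ) (V : Set (ℝ × ℝ)) : Prop :=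
  IsCCWBoundaryParam γ V ∧
  ∀ i : ℕ, ∀ s ∈ Icc (0 : ℝ) 1, γ ((i + s) / n) = (1 - s) • v i + s • v (i + 1)

/-- `V` is the simple polygon (compact region bounded by a simple closed polygonal curve)
with vertices `v 0, …, v (n-1)` listed in counterclockwise order. -/
def IsSimplePolygonCCW (V : Set (ℝ × ℝ)) (n : ℕ) (v : ℕ → ℝ × ℝ) : Prop :=
  3 ≤ n ∧ (∀ i, v (i + n) = v i) ∧ IsCompact V ∧ V = closure (interior V) ∧
  (interior V).Nonempty ∧ ∃ γ, IsPolygonalCCWParam γ n v V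

/-- `W` is the convex polygon with vertices `w 0, …, w (n-1)`, which lie on its boundary
in counterclockwise order. -/
def IsConvexPolygonCCW (W : Set (ℝ × ℝ)) (n : ℕ) (w : ℕ → ℝ × ℝ) : Prop :=
  (∀ i, w (i + n) = w i) ∧ W = convexHull ℝ (range w) ∧ ∃ γ, IsPolygonalCCWParam γ n w W

/-- `φ 0, …, φ (n-1)` are harmonic generalized barycentric coordinates on the polygon `V`
with vertices `v 0, …, v (n-1)`. -/
def IsHarmonicGBC (n : ℕ) (v : ℕ → ℝ × ℝ) (V : Set (ℝ × ℝ)) (φ : ℕ → (ℝ × ℝ) → ℝ) : Prop :=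
  (∀ i, ContinuousOn (φ i) V) ∧ (∀ i, HarmonicOn2 (φ i) (interior V)) ∧
  (∀ x ∈ V, ∑ i ∈ Finset.range n, φ i x = 1) ∧
  (∀ x ∈ V, ∑ i ∈ Finset.range n, φ i x • v i = x) ∧
  (∀ i, ∀ x ∈ V, 0 ≤ φ i x) ∧
  (∀ i j, ∀ s ∈ Icc (0 : ℝ) 1,
    φ i ((1 - s) • v j + s • v (j + 1)) = (1 - s) * φ i (v j) + s * φ i (v (j + 1))) ∧
  (∀ i j, i < n → j < n → φ i (v j) = if i = j then 1 else 0)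

theorem exists_continuous_exp_eq {X : Type*} [TopologicalSpace X] [SimplyConnectedSpace X]
    [LocallyPathConnectedSpace X] {f : X → ℂ} (hf : Continuous f) (h0 : ∀ x, f x ≠ 0) :
    ∃ L : X → ℂ, Continuous L ∧ ∀ x, Complex.exp (L x) = f x := by
  obtain ⟨x₀⟩ : Nonempty X := inferInstance
  obtain ⟨L, ⟨-, hL⟩, -⟩ := Complex.isCoveringMapOn_exp.existsUnique_continuousMap_lifts
    ⟨f, hf⟩ (Complex.exp_log (h0 x₀)) (fun x => h0 x)
  exact ⟨L, L.continuous, fun x => congr_fun hL x⟩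

theorem sub_eq_sub_of_exp_eq {X : Type*} [TopologicalSpace X] [PreconnectedSpace X]
    {L L' : X → ℂ} (hL : Continuous L) (hL' : Continuous L')
    (h : ∀ x, Complex.exp (L x) = Complex.exp (L' x)) (x y : X) :
    L x - L' x = L y - L' y := by
  refine Complex.isCoveringMap_exp.const_of_comp (g := fun x => L x - L' x) (hL.sub hL')
    (fun a a' => ?_) x y
  simp [Complex.exp_sub, h]

theorem exists_continuous_exp_eq_unitSquare {f : unitInterval × unitInterval → ℂ}
    (hf : Continuous f) (h0 : ∀ x, f x ≠ 0) :
    ∃ L : unitInterval × unitInterval → ℂ, Continuous L ∧ ∀ x, Complex.exp (L x) = f x := by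
  obtain ⟨L, hL, hLe⟩ := exists_continuous_exp_eq (X := ℝ × ℝ)
    (f := fun p => f (projIcc 0 1 zero_le_one p.1, projIcc 0 1 zero_le_one p.2))
    (hf.comp (by fun_prop)) (fun _ => h0 _)
  exact ⟨fun p => L (p.1, p.2), by fun_prop, fun p => by simp [hLe]⟩

/-- Two paths whose endpoints alternate along the two diagonals of a kite cannot be closed up by
the diagonals without crossing. -/
theorem false_of_crossing_paths {σ q r : ℝ} (hσ : 0 < σ) (hq : q < 0) (hr : 0 < r)
    (Q : Path (r : ℂ) (q : ℂ)) (α : Path (-(σ * Complex.I)) (σ * Complex.I))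
    (hQα : ∀ s t, Q t ≠ α s) (hα : ∀ s, ∀ x ∈ Icc q r, α s ≠ (x : ℂ))
    (hQ : ∀ t, (Q t).re = 0 → σ < |(Q t).im|) : False := by
  have hS : ∀ t ∈ Icc (0 : ℝ) 1, q + t * (r - q) ∈ Icc q r := by
    rintro t ⟨h0, h1⟩
    constructor <;> nlinarith
  obtain ⟨L₁, hL₁, hL₁e⟩ := exists_continuous_exp_eq_unitSquare
    (f := fun p => Q p.2 - α p.1) (by fun_prop) (fun p => sub_ne_zero.2 (hQα _ _))
  obtain ⟨L₂, hL₂, hL₂e⟩ := exists_continuous_exp_eq_unitSquare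
    (f := fun p => ((q + p.2 * (r - q) : ℝ) : ℂ) - α p.1) (by fun_prop)
    (fun p => sub_ne_zero.2 (hα _ _ (hS _ p.2.2)).symm)
  have key := sub_eq_sub_of_exp_eq
    (L := fun s : unitInterval => L₁ (s, 1) - L₁ (s, 0) + (L₂ (s, 1) - L₂ (s, 0)))
    (L' := fun _ => 0) (by fun_prop) (by fun_prop) (fun s => by
      have h1 := sub_ne_zero.2 (hQα s 0)
      have h2 := sub_ne_zero.2 (hQα s 1)
      simp only [Path.source, Path.target] at h1 h2
      simp [Complex.exp_add, Complex.exp_sub, hL₁e, hL₂e]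
      field_simp) 0 1
  have ne1 : ∀ z : ℂ, (z.re = 0 → σ < |z.im|) → z - σ * Complex.I ≠ 0 := by
    intro z hz h
    have e : z = σ * Complex.I := sub_eq_zero.1 h
    have := hz (by simp [e])
    simp [e, abs_of_pos hσ] at this
  have hslit : ∀ z : ℂ, (z.re = 0 → σ < |z.im|) →
      (z + σ * Complex.I) / (z - σ * Complex.I) ∈ Complex.slitPlane := by
    intro z hz
    have hne := ne1 z hz
    have hn : 0 < Complex.normSq (z - σ * Complex.I) := Complex.normSq_pos.2 hne
    rw [Complex.mem_slitPlane_iff]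
    by_cases h : z.re = 0
    · left
      have h1 := hz h
      have h2 : σ ^ 2 < z.im ^ 2 := by
        rw [← sq_abs z.im]; gcongr
      rw [Complex.div_re, ← add_div]
      apply div_pos _ hn
      simp [h]
      nlinarith
    · right
      rw [Complex.div_im, ← sub_div]
      refine div_ne_zero ?_ hn.ne'
      simp
      intro h'
      have : z.re * σ = 0 := by linarith
      simp [h, hσ.ne'] at this
  have hreal : ∀ y : ℝ, (y : ℂ) - σ * Complex.I ≠ 0 := fun y h => by
    have := congrArg Complex.im h
    simp [hσ.ne'] at this
  have k1 := sub_eq_sub_of_exp_eq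
    (L := fun t : unitInterval => L₁ (0, t) - L₁ (1, t))
    (L' := fun t => Complex.log ((Q t + σ * Complex.I) / (Q t - σ * Complex.I)))
    (by fun_prop) (by
      refine Continuous.clog (Continuous.div (by fun_prop) (by fun_prop) fun t => ne1 _ (hQ t))
        fun t => hslit _ (hQ t)) (fun t => by
      rw [Complex.exp_log (Complex.slitPlane_ne_zero (hslit _ (hQ t)))]
      simp [Complex.exp_sub, hL₁e]) 0 1
  have hup : ∀ y : ℝ, (y : ℂ) + σ * Complex.I ∈ Complex.slitPlane := fun y => by
    rw [Complex.mem_slitPlane_iff]; right; simp [hσ.ne']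
  have k2 := sub_eq_sub_of_exp_eq
    (L := fun t : unitInterval => L₂ (0, t) - L₂ (1, t))
    (L' := fun t => 2 * Complex.arg (((q + t * (r - q) : ℝ) : ℂ) + σ * Complex.I) * Complex.I)
    (by fun_prop) (by
      refine Continuous.mul (continuous_const.mul (Complex.continuous_ofReal.comp ?_))
        continuous_const
      refine continuous_iff_continuousAt.2 fun t => ?_
      refine ContinuousAt.comp (f := fun t : unitInterval =>
        ((q + t * (r - q) : ℝ) : ℂ) + σ * Complex.I) (Complex.continuousAt_arg (hup _))
        (by fun_prop))
    (fun t => by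
      set y := q + (t : ℝ) * (r - q) with hy
      have e1 : Complex.exp (L₂ (0, t) - L₂ (1, t)) =
          ((y : ℂ) + σ * Complex.I) / (y - σ * Complex.I) := by
        rw [Complex.exp_sub, hL₂e, hL₂e]
        simp [hy]
      set z := (y : ℂ) + σ * Complex.I with hz
      have hz0 : z ≠ 0 := Complex.slitPlane_ne_zero (hup y)
      have hn : (‖z‖ : ℂ) ≠ 0 := by simpa using hz0
      have e2 := Complex.norm_mul_exp_arg_mul_I z
      have e3 : (y : ℂ) - σ * Complex.I = (starRingEnd ℂ) z := by simp [hz]; ring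
      have e4 : z * (starRingEnd ℂ) z = ‖z‖ ^ 2 := Complex.mul_conj' z
      have e5 : (starRingEnd ℂ) z ≠ 0 := by simpa using hz0
      rw [e1, e3, mul_assoc, two_mul, Complex.exp_add, div_eq_iff e5]
      have : Complex.exp (z.arg * Complex.I) = z / ‖z‖ := by
        rw [eq_div_iff hn, mul_comm]; exact e2
      rw [this]
      field_simp
      linear_combination (-1 : ℂ) * e4) 0 1
  have sq : Complex.arg ((q + σ * Complex.I) / (q - σ * Complex.I)) < 0 := by
    rw [Complex.arg_neg_iff, Complex.div_im, ← sub_div]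
    apply div_neg_of_neg_of_pos _ (Complex.normSq_pos.2 (hreal q))
    simp; nlinarith
  have sr : 0 ≤ Complex.arg ((r + σ * Complex.I) / (r - σ * Complex.I)) := by
    rw [Complex.arg_nonneg_iff, Complex.div_im, ← sub_div]
    apply div_nonneg _ (Complex.normSq_nonneg _)
    simp; nlinarith
  have ar : Complex.arg (r + σ * Complex.I) ≤ Real.pi / 2 := by
    have := (Complex.abs_arg_le_pi_div_two_iff (z := r + σ * Complex.I)).2 (by simp [hr.le])
    exact (abs_le.1 this).2
  have aq : Real.pi / 2 ≤ Complex.arg (q + σ * Complex.I) := by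
    by_contra! hlt
    have h0 : 0 ≤ Complex.arg (q + σ * Complex.I) := Complex.arg_nonneg_iff.2 (by simp [hσ.le])
    have := (Complex.abs_arg_le_pi_div_two_iff (z := q + σ * Complex.I)).1
      (abs_le.2 ⟨by linarith [Real.pi_pos], hlt.le⟩)
    simp at this
    linarith
  have key' := congrArg Complex.im key
  have k1' := congrArg Complex.im k1
  have k2' := congrArg Complex.im k2
  simp [Complex.log_im] at key' k1' k2'
  linarith

/-- An arc does not contain the frontier of a bounded open subset of the plane off the arc. -/
theorem not_frontier_subset_arc {C : Set ℂ} (hCb : Bornology.IsBounded C)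
    (hC : C.Nonempty) {a b : ℝ} {g : ℝ → ℂ} (hg : ContinuousOn g (Icc a b))
    (hinj : InjOn g (Icc a b)) (hdisj : Disjoint C (g '' Icc a b)) :
    ¬ frontier C ⊆ g '' Icc a b := by
  intro hsub
  obtain ⟨z, hz⟩ := hC
  have hab : a ≤ b := by
    by_contra hab
    rw [Icc_eq_empty hab, image_empty, subset_empty_iff, frontier_eq_empty_iff] at hsub
    rcases hsub with h | h
    · simp [h] at hz
    · rw [h] at hCb
      exact NormedSpace.unbounded_univ ℝ ℂ hCb
  have hgz : ∀ t ∈ Icc a b, g t ≠ z := fun t ht h =>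
    disjoint_left.1 hdisj hz ⟨t, ht, h⟩
  obtain ⟨L, hL, hLe⟩ := exists_continuous_exp_eq (X := ℝ)
    (f := fun t => g (projIcc a b hab t) - z)
    ((continuousOn_iff_continuous_domRestrict.1 hg).comp continuous_projIcc |>.sub
      continuous_const)
    (fun t => sub_ne_zero.2 (hgz _ (projIcc a b hab t).2))
  have hemb : IsClosedEmbedding (fun t : Icc a b => g t) :=
    (continuousOn_iff_continuous_domRestrict.1 hg).isClosedEmbedding (injOn_iff_injective.1 hinj)
  obtain ⟨Λ, hΛ⟩ := ContinuousMap.exists_extension' hemb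
    (⟨fun t : Icc a b => L t, by fun_prop⟩ : C(Icc a b, ℂ))
  have hΛe : ∀ x ∈ g '' Icc a b, Complex.exp (Λ x) = x - z := by
    rintro _ ⟨t, ht, rfl⟩
    have := congr_fun hΛ ⟨t, ht⟩
    simp only [Function.comp_apply, ContinuousMap.coe_mk] at this
    rw [this, hLe, projIcc_of_mem hab ht]
  classical
  obtain ⟨M, hM, hMe⟩ := exists_continuous_exp_eq (X := ℂ)
    (f := fun x => if x ∈ C then Complex.exp (Λ x) else x - z)
    (Continuous.if (fun x hx => hΛe x (hsub hx)) (by fun_prop) (by fun_prop))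
    (fun x => by
      split_ifs with hx
      · exact Complex.exp_ne_zero _
      · exact sub_ne_zero.2 fun h => hx (h ▸ hz))
  obtain ⟨R, hR0, hR⟩ := hCb.subset_ball_lt 0 z
  have hout : ∀ θ : ℝ, z + R * Complex.exp (θ * Complex.I) ∉ C := fun θ h => by
    have := hR h
    simp [Complex.norm_exp_ofReal_mul_I, abs_of_pos hR0] at this
  have key := sub_eq_sub_of_exp_eq
    (L := fun θ : ℝ => M (z + R * Complex.exp (θ * Complex.I)))
    (L' := fun θ => Real.log R + θ * Complex.I) (by fun_prop) (by fun_prop) (fun θ => by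
      rw [hMe, if_neg (hout θ), Complex.exp_add, ← Complex.ofReal_exp, Real.exp_log hR0]
      ring) 0 (2 * Real.pi)
  have e : Complex.exp (((2 * Real.pi : ℝ) : ℂ) * Complex.I) = 1 := by
    push_cast; exact Complex.exp_two_pi_mul_I
  rw [e] at key
  simp at key

section MaximumPrinciple

open InnerProductSpace

theorem InnerProductSpace.HarmonicAt.exists_analyticAt_re_eq {h : ℂ → ℝ} {z : ℂ}
    (hh : HarmonicAt h z) :
    ∃ H : ℂ → ℂ, AnalyticAt ℂ H z ∧ ∀ᶠ x in 𝓝 z, (H x).re = h x := by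
  obtain ⟨ε, hε, hball⟩ := Metric.isOpen_iff.1 (isOpen_setOfPred_harmonicAt (f := h)) z hh
  obtain ⟨H, hH, hre⟩ := HarmonicOnNhd.exists_analyticOnNhd_ball_re_eq fun x hx => hball hx
  exact ⟨H, hH z (Metric.mem_ball_self hε), eventually_of_mem (Metric.ball_mem_nhds z hε) hre⟩

theorem InnerProductSpace.HarmonicAt.eventually_eq_of_isLocalMax {h : ℂ → ℝ} {z : ℂ}
    (hh : HarmonicAt h z) (hmax : IsLocalMax h z) : ∀ᶠ x in 𝓝 z, h x = h z := by
  obtain ⟨H, hH, hre⟩ := hh.exists_analyticAt_re_eq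
  have hz := hre.self_of_nhds
  have := Complex.eventually_eq_of_isLocalMax_norm (f := fun x => Complex.exp (H x)) (c := z)
    (hH.eventually_analyticAt.mono fun x hx => hx.differentiableAt.cexp) (by
      filter_upwards [hmax, hre] with x hx hx'
      simp [Complex.norm_exp, hx', hz, hx])
  filter_upwards [this, hre] with x hx hx'
  have := congrArg norm hx
  simpa [Complex.norm_exp, hx', hz] using this

theorem eqOn_const_of_isPreconnected_of_eventuallyEq {h : ℂ → ℝ} {C : Set ℂ} {c : ℝ}
    (hh : HarmonicOnNhd h C) (hC : IsPreconnected C) {z : ℂ} (hz : z ∈ C)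
    (hev : ∀ᶠ x in 𝓝 z, h x = c) : ∀ x ∈ C, h x = c :=
  AnalyticOnNhd.eqOn_of_preconnected_of_eventuallyEq (𝕜 := ℝ)
    (fun x hx => _root_.HarmonicAt.analyticAt (hh x hx)) (fun _ _ => analyticAt_const) hC hz hev

/-- Weak maximum principle for harmonic functions on bounded open sets. -/
theorem le_of_forall_frontier_le {h : ℂ → ℝ} {U : Set ℂ} {c : ℝ} (hU : IsOpen U)
    (hb : Bornology.IsBounded U) (hcont : ContinuousOn h (closure U)) (hh : HarmonicOnNhd h U)
    (hfr : ∀ x ∈ frontier U, h x ≤ c) : ∀ z ∈ U, h z ≤ c := by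
  intro z hz
  by_contra! hlt
  obtain ⟨x, hxU, hx⟩ := hb.isCompact_closure.exists_isMaxOn ⟨z, subset_closure hz⟩ hcont
  have hmem : ∀ y ∈ closure U, h y = h x → y ∈ U := by
    intro y hy hyx
    by_contra hyU
    have h1 := hfr y ⟨hy, by rwa [hU.interior_eq]⟩
    have h2 : h z ≤ h x := hx (subset_closure hz)
    linarith
  have hopen : IsOpen {y ∈ U | h y = h x} := by
    refine isOpen_iff_mem_nhds.2 fun y hy => ?_
    have := (hh y hy.1).eventually_eq_of_isLocalMax (by
      filter_upwards [hU.mem_nhds hy.1] with w hw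
      rw [hy.2]; exact hx (subset_closure hw))
    filter_upwards [this, hU.mem_nhds hy.1] with w hw hw'
    exact ⟨hw', hw.trans hy.2⟩
  have hclosed : IsClosed {y ∈ U | h y = h x} := by
    have : {y ∈ U | h y = h x} = closure U ∩ h ⁻¹' {h x} := by
      ext y
      exact ⟨fun hy => ⟨subset_closure hy.1, hy.2⟩, fun hy => ⟨hmem y hy.1 hy.2, hy.2⟩⟩
    rw [this]
    exact hcont.preimage_isClosed_of_isClosed isClosed_closure isClosed_singleton
  rcases isClopen_iff.1 ⟨hclosed, hopen⟩ with h' | h'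
  · have : x ∈ {y ∈ U | h y = h x} := ⟨hmem x hxU rfl, rfl⟩
    simp [h'] at this
  · exact NormedSpace.unbounded_univ ℝ ℂ (hb.subset fun y _ => (h' ▸ mem_univ y :
      y ∈ {y ∈ U | h y = h x}).1)

/-- Near a critical point, a nonconstant harmonic function takes alternately larger and smaller
values along four consecutive rays. -/
theorem InnerProductSpace.HarmonicAt.exists_alternating_rays {h : ℂ → ℝ} {z : ℂ}
    (hh : HarmonicAt h z) (hd : fderiv ℝ h z = 0) (hne : ¬ ∀ᶠ x in 𝓝 z, h x = h z) :
    ∃ m : ℕ, 2 ≤ m ∧ ∃ u ζ : ℂ, u ≠ 0 ∧ ζ = Complex.exp ((Real.pi / m : ℝ) * Complex.I) ∧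
      ∀ᶠ t : ℝ in 𝓝[>] 0, h z < h (z + t * (u * (starRingEnd ℂ) ζ)) ∧ h z < h (z + t * (u * ζ)) ∧
        h (z + t * u) < h z ∧ h (z + t * (u * ζ ^ 2)) < h z := by
  obtain ⟨H, hH, hre⟩ := hh.exists_analyticAt_re_eq
  have hz := hre.self_of_nhds
  have hf : AnalyticAt ℂ (fun x => H x - H z) z := hH.sub analyticAt_const
  obtain ⟨n, g, hg, hg0, hfg⟩ := hf.exists_eventuallyEq_pow_smul_nonzero_iff.2 fun h' => hne (by
    filter_upwards [h', hre] with x hx hx'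
    rw [← hx', ← hz, sub_eq_zero.1 hx])
  have hn : 2 ≤ n := by
    by_contra! hlt
    interval_cases n
    · have := hfg.self_of_nhds
      simp at this
      exact hg0 this.symm
    · have hdH : HasDerivAt H (g z) z := by
        have h1 : HasDerivAt (fun x => H z + (x - z) * g x) (1 * g z + (z - z) * deriv g z) z :=
          (((hasDerivAt_id z).sub_const z).mul hg.differentiableAt.hasDerivAt).const_add _
        simp only [sub_self, zero_mul, add_zero, one_mul] at h1
        refine h1.congr_of_eventuallyEq ?_
        filter_upwards [hfg] with x hx
        simp at hx
        rw [← hx]; ring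
      have h2 : HasFDerivAt h (Complex.reCLM.comp
          ((ContinuousLinearMap.toSpanSingleton ℂ (g z)).restrictScalars ℝ)) z :=
        (Complex.reCLM.hasFDerivAt.comp z (hdH.hasFDerivAt.restrictScalars ℝ)).congr_of_eventuallyEq
          (by filter_upwards [hre] with x hx using hx.symm)
      have h3 := DFunLike.congr_fun (h2.fderiv.symm.trans hd) ((starRingEnd ℂ) (g z))
      have h4 : (((starRingEnd ℂ) (g z)) * g z).re = 0 := by simpa using h3
      rw [mul_comm, Complex.mul_conj] at h4
      exact hg0 (Complex.normSq_eq_zero.1 (by simpa using h4))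
  have hn0 : n ≠ 0 := by omega
  obtain ⟨u, hu⟩ := IsAlgClosed.exists_pow_nat_eq (-(starRingEnd ℂ) (g z)) (Nat.pos_of_ne_zero hn0)
  have hu0 : u ≠ 0 := by
    rintro rfl
    rw [zero_pow hn0] at hu
    exact hg0 (by simpa using hu.symm)
  have hgu : g z * u ^ n = -(Complex.normSq (g z) : ℂ) := by
    rw [hu, mul_neg, Complex.mul_conj]
  have hpos : 0 < Complex.normSq (g z) := Complex.normSq_pos.2 hg0
  have hray : ∀ w : ℂ, Tendsto (fun t : ℝ => z + t * w) (𝓝[>] 0) (𝓝 z) := fun w =>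
    tendsto_nhdsWithin_of_tendsto_nhds
      ((by fun_prop : Continuous fun t : ℝ => z + t * w).tendsto' 0 z (by simp))
  have hexp : ∀ w : ℂ, ∀ᶠ t : ℝ in 𝓝[>] 0,
      h (z + t * w) - h z = t ^ n * (w ^ n * g (z + t * w)).re := by
    intro w
    filter_upwards [(hray w).eventually hre, (hray w).eventually hfg] with t h1 h2
    rw [← h1, ← hz, ← Complex.sub_re, h2, smul_eq_mul, add_sub_cancel_left, mul_pow, mul_assoc,
      ← Complex.ofReal_pow, Complex.re_ofReal_mul]
  have hlim : ∀ w : ℂ, Tendsto (fun t : ℝ => (w ^ n * g (z + t * w)).re) (𝓝[>] 0)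
      (𝓝 (w ^ n * g z).re) := fun w =>
    (Complex.continuous_re.tendsto _).comp
      ((tendsto_const_nhds).mul (hg.continuousAt.tendsto.comp (hray w)))
  have hplus : ∀ w : ℂ, 0 < (w ^ n * g z).re → ∀ᶠ t : ℝ in 𝓝[>] 0, h z < h (z + t * w) := by
    intro w hw
    filter_upwards [hexp w, (hlim w).eventually (lt_mem_nhds hw), self_mem_nhdsWithin]
      with t h1 h2 (h3 : 0 < t)
    have := mul_pos (pow_pos h3 n) h2
    linarith
  have hminus : ∀ w : ℂ, (w ^ n * g z).re < 0 → ∀ᶠ t : ℝ in 𝓝[>] 0, h (z + t * w) < h z := by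
    intro w hw
    filter_upwards [hexp w, (hlim w).eventually (gt_mem_nhds hw), self_mem_nhdsWithin]
      with t h1 h2 (h3 : 0 < t)
    have := mul_neg_of_pos_of_neg (pow_pos h3 n) h2
    linarith
  have hζ : (Complex.exp ((Real.pi / n : ℝ) * Complex.I)) ^ n = -1 := by
    rw [← Complex.exp_nat_mul, ← Complex.exp_pi_mul_I]
    congr 1
    push_cast
    field_simp
  refine ⟨n, hn, u, _, hu0, rfl, ?_⟩
  refine (hplus _ ?_).and ((hplus _ ?_).and ((hminus _ ?_).and (hminus _ ?_)))
  · rw [mul_pow, ← map_pow, hζ, mul_right_comm, mul_comm (u ^ n), hgu]; simpa using hg0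
  · rw [mul_pow, hζ, mul_right_comm, mul_comm (u ^ n), hgu]; simpa using hg0
  · rw [mul_comm, hgu]; simpa using hg0
  · rw [mul_pow, ← pow_mul, mul_comm 2 n, pow_mul, hζ, mul_right_comm, mul_comm (u ^ n), hgu]
    simpa using hg0

end MaximumPrinciple

theorem false_of_joinedIn_rays {P N : Set ℂ} (hP : ∀ x ∈ P, ∀ y ∈ P, JoinedIn P x y)
    (hN : ∀ x ∈ N, ∀ y ∈ N, JoinedIn N x y) (hPN : Disjoint P N) (h0P : (0 : ℂ) ∉ P)
    (h0N : (0 : ℂ) ∉ N) {m : ℕ} (hm : 2 ≤ m) {ζ : ℂ}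
    (hζ : ζ = Complex.exp ((Real.pi / m : ℝ) * Complex.I)) {r : ℝ} (hr : 0 < r)
    (h : ∀ t ∈ Ioc 0 r, t * (starRingEnd ℂ) ζ ∈ P ∧ t * ζ ∈ P ∧ (t : ℂ) ∈ N ∧
      t * ζ ^ 2 ∈ N) : False := by
  set θ : ℝ := Real.pi / m with hθ
  have hm2 : (2 : ℝ) ≤ m := by exact_mod_cast hm
  have hθ0 : 0 < θ := by positivity
  have hθ2 : θ ≤ Real.pi / 2 := by
    rw [hθ]; gcongr
  have hsin : 0 < Real.sin θ := Real.sin_pos_of_pos_of_lt_pi hθ0 (by linarith [Real.pi_pos])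
  have hcos : 0 ≤ Real.cos θ := Real.cos_nonneg_of_neg_pi_div_two_le_of_le (by linarith) hθ2
  have hre : ζ.re = Real.cos θ := by rw [hζ, Complex.exp_ofReal_mul_I_re]
  have him : ζ.im = Real.sin θ := by rw [hζ, Complex.exp_ofReal_mul_I_im]
  obtain ⟨-, -, hr1, hr2⟩ := h r ⟨hr, le_rfl⟩
  set β := (hN _ hr1 _ hr2).somePath with hβ
  have hβN : ∀ t, β t ∈ N := fun t => (hN _ hr1 _ hr2).somePath_mem t
  obtain ⟨δ, hδ, hδβ⟩ : ∃ δ > 0, ∀ t, δ ≤ ‖β t‖ := by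
    obtain ⟨t, ht⟩ := (isCompact_univ (X := unitInterval)).exists_isMinOn univ_nonempty
      (f := fun t => ‖β t‖) (by fun_prop)
    refine ⟨‖β t‖, norm_pos_iff.2 fun h' => h0N (h' ▸ hβN t), fun s => ht.2 (mem_univ s)⟩
  obtain ⟨ρ, hρ0, hρ⟩ := exists_between (lt_min hδ hr)
  obtain ⟨hρδ, hρr⟩ := lt_min_iff.1 hρ
  obtain ⟨ha, hb, -, -⟩ := h ρ ⟨hρ0, hρr.le⟩
  set α := (hP _ ha _ hb).somePath with hα
  have hαP : ∀ t, α t ∈ P := fun t => (hP _ ha _ hb).somePath_mem t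
  set c := ρ * Real.cos θ with hc
  set σ := ρ * Real.sin θ with hσ
  have hσ0 : 0 < σ := mul_pos hρ0 hsin
  have hc0 : 0 ≤ c := mul_nonneg hρ0.le hcos
  have hcr : c < r := by nlinarith [Real.cos_le_one θ]
  have hcσ : c ^ 2 + σ ^ 2 = ρ ^ 2 := by
    rw [hc, hσ]; linear_combination ρ ^ 2 * Real.sin_sq_add_cos_sq θ
  have hbig : ∀ t, (β t).re = c → σ < |(β t).im| := by
    intro t ht
    have h1 := hδβ t
    have h2 : ρ ^ 2 < ‖β t‖ ^ 2 := by gcongr; linarith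
    rw [Complex.sq_norm, Complex.normSq_apply, ht] at h2
    exact lt_abs.2 (by by_contra! h3; nlinarith)
  have main : ∀ (q : ℝ) (Q : Path (r : ℂ) (q : ℂ)), q < c → (∀ t, Q t ∈ N ∨ Q t = 0) →
      (∀ x ∈ Icc q r, (x : ℂ) ∈ N ∨ (x : ℂ) = 0) → (∀ t, (Q t).re = c → σ < |(Q t).im|) →
      False := by
    intro q Q hq hQN hx hQ
    have hsep : ∀ x, x ∈ N ∨ x = 0 → x ∉ P := by
      rintro x (h1 | rfl) h2
      · exact disjoint_left.1 hPN h2 h1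
      · exact h0P h2
    refine false_of_crossing_paths hσ0 (sub_neg.2 hq) (sub_pos.2 hcr)
      ((Q.map (f := fun x => x - c) (by fun_prop)).cast (by simp) (by simp))
      ((α.map (f := fun x => x - c) (by fun_prop)).cast ?_ ?_) ?_ ?_ ?_
    · apply Complex.ext <;> simp [hre, him, ← hc, ← hσ]
    · apply Complex.ext <;> simp [hre, him, ← hc, ← hσ]
    · intro s t hst
      simp at hst
      exact hsep _ (hQN t) (hst ▸ hαP s)
    · intro s x hxm hs
      simp at hs
      refine hsep ((x + c : ℝ) : ℂ) (hx (x + c) ⟨by linarith [hxm.1], by linarith [hxm.2]⟩) ?_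
      have : α s = ((x + c : ℝ) : ℂ) := by push_cast; linear_combination hs
      exact this ▸ hαP s
    · intro t ht
      simp at ht ⊢
      exact hQ t (by linarith)
  have hxpos : ∀ x : ℝ, 0 < x → x ≤ r → (x : ℂ) ∈ N := fun x h1 h2 => (h x ⟨h1, h2⟩).2.2.1
  have hζ2 : ζ ^ 2 = ⟨Real.cos (2 * θ), Real.sin (2 * θ)⟩ := by
    apply Complex.ext
    · rw [sq, Complex.mul_re, hre, him, Real.cos_two_mul']; ring
    · rw [sq, Complex.mul_im, hre, him, Real.sin_two_mul]; ring
  rcases hm.eq_or_lt with rfl | hm3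
  · have hζm : ζ ^ 2 = -1 := by
      rw [hζ, ← Complex.exp_nat_mul, ← Complex.exp_pi_mul_I, hθ]
      congr 1
      push_cast
      ring
    have hc' : c = 0 := by rw [hc, hθ]; simp
    refine main (-r) (β.cast rfl (by rw [hζm]; simp)) (by linarith) (fun t => Or.inl (hβN t)) ?_
      hbig
    intro x hx
    rcases lt_trichotomy x 0 with hx0 | rfl | hx0
    · left
      have := (h (-x) ⟨by linarith, by linarith [hx.1]⟩).2.2.2
      rw [hζm] at this
      simpa using this
    · right; simp
    · exact Or.inl (hxpos x hx0 hx.2)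
  · have hm3' : (3 : ℝ) ≤ m := by exact_mod_cast hm3
    have hθ3 : θ < Real.pi / 2 := by
      rw [hθ]; gcongr; linarith
    have hcos' : 0 < Real.cos θ := Real.cos_pos_of_mem_Ioo ⟨by linarith, hθ3⟩
    have hc' : 0 < c := mul_pos hρ0 hcos'
    set Q := β.trans (Path.segment ((r : ℂ) * ζ ^ 2) 0) with hQ
    have hQm : ∀ t, (∃ s, Q t = β s) ∨ Q t = 0 ∨ ∃ τ ∈ Ioc 0 r, Q t = τ * ζ ^ 2 := by
      intro t
      have : Q t ∈ range Q := mem_range_self t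
      rw [hQ, Path.trans_range, Path.range_segment] at this
      rcases this with ⟨s, hs⟩ | ⟨a, b, ha, hb, hab, hs⟩
      · exact Or.inl ⟨s, hs.symm⟩
      · right
        simp only [smul_zero, add_zero] at hs
        rcases ha.eq_or_lt with rfl | ha'
        · left; rw [hQ, ← hs]; simp
        · right
          exact ⟨a * r, ⟨by positivity, by nlinarith⟩, by rw [hQ, ← hs]; simp [mul_assoc]⟩
    refine main 0 (Q.cast rfl (by simp)) hc' ?_ ?_ ?_
    · intro t
      rcases hQm t with ⟨s, hs⟩ | hs | ⟨τ, hτ, hs⟩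
      · left; rw [Path.cast_coe, hs]; exact hβN s
      · right; exact hs
      · left; rw [Path.cast_coe, hs]; exact (h τ hτ).2.2.2
    · intro x hx
      rcases hx.1.eq_or_lt with rfl | hx0
      · right; simp
      · exact Or.inl (hxpos x hx0 hx.2)
    · intro t
      rw [Path.cast_coe]
      rcases hQm t with ⟨s, hs⟩ | hs | ⟨τ, hτ, hs⟩
      · rw [hs]; exact hbig s
      · rw [hs]; intro h'; simp at h'; linarith
      · rw [hs, hζ2]
        simp only [Complex.re_ofReal_mul, Complex.im_ofReal_mul]
        intro h'
        have h2 : 0 < Real.cos (2 * θ) := by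
          by_contra! h3
          nlinarith [hτ.1]
        refine lt_of_lt_of_le ?_ (le_abs_self _)
        rw [Real.sin_two_mul, hσ]
        have h4 := Real.cos_two_mul θ
        have h5 : τ * (2 * Real.sin θ * Real.cos θ) * Real.cos (2 * θ) =
            2 * ρ * Real.sin θ * Real.cos θ ^ 2 := by
          linear_combination (2 * Real.sin θ * Real.cos θ) * h' 
        refine lt_of_mul_lt_mul_right (a := Real.cos (2 * θ)) ?_ h2.le
        rw [h5, h4]
        nlinarith

/-- Two disjoint connected open sets cannot alternate along four rays issuing from a point outside
both of them. -/
theorem false_of_alternating_rays {P N : Set ℂ} (hP : IsOpen P) (hPc : IsPreconnected P)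
    (hN : IsOpen N) (hNc : IsPreconnected N) (hPN : Disjoint P N) {z : ℂ} (hzP : z ∉ P)
    (hzN : z ∉ N) {m : ℕ} (hm : 2 ≤ m) {u ζ : ℂ} (hu : u ≠ 0)
    (hζ : ζ = Complex.exp ((Real.pi / m : ℝ) * Complex.I))
    (h : ∀ᶠ t : ℝ in 𝓝[>] 0, z + t * (u * (starRingEnd ℂ) ζ) ∈ P ∧ z + t * (u * ζ) ∈ P ∧
      z + t * u ∈ N ∧ z + t * (u * ζ ^ 2) ∈ N) : False := by
  obtain ⟨r, hr, hrt⟩ := mem_nhdsGT_iff_exists_Ioc_subset.1 h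
  set f : ℂ → ℂ := fun x => z + u * x with hf
  have hjoin : ∀ S : Set ℂ, IsOpen S → IsPreconnected S →
      ∀ x ∈ f ⁻¹' S, ∀ y ∈ f ⁻¹' S, JoinedIn (f ⁻¹' S) x y := by
    intro S hS hSc x hx y hy
    have h1 := ((hS.isConnected_iff_isPathConnected.1 ⟨⟨_, hx⟩, hSc⟩).joinedIn _ hx _ hy).map
      (f := fun x => (x - z) / u) (by fun_prop)
    simp only [hf, add_sub_cancel_left, mul_div_cancel_left₀ _ hu] at h1
    refine h1.mono ?_
    rintro _ ⟨s, hs, rfl⟩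
    have e : f ((s - z) / u) = s := by simp only [hf]; field_simp; ring
    rwa [mem_preimage, e]
  refine false_of_joinedIn_rays (hjoin P hP hPc) (hjoin N hN hNc) (hPN.preimage f)
    (by simpa [hf]) (by simpa [hf]) hm hζ hr fun t ht => ?_
  have := hrt ht
  simp only [hf, mem_preimage]
  refine ⟨?_, ?_, ?_, ?_⟩
  · convert this.1 using 1; ring
  · convert this.2.1 using 1; ring
  · convert this.2.2.1 using 1; ring
  · convert this.2.2.2 using 1; ring

theorem mem_connectedComponentIn_of_mem_closure {X : Type*} [TopologicalSpace X] {U : Set X}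
    {x y : X} (hx : x ∈ U) (h : x ∈ closure (connectedComponentIn U y)) :
    x ∈ connectedComponentIn U y := by
  have hne : (connectedComponentIn U y).Nonempty := closure_nonempty_iff.1 ⟨x, h⟩
  have hins : IsPreconnected (insert x (connectedComponentIn U y)) :=
    isPreconnected_connectedComponentIn.subset_closure (subset_insert _ _)
      (insert_subset h subset_closure)
  exact hins.subset_connectedComponentIn
    (mem_insert_of_mem _ (mem_connectedComponentIn (connectedComponentIn_nonempty_iff.1 hne)))
    (insert_subset hx (connectedComponentIn_subset U y)) (mem_insert x _)

/-- An open set that meets `V` in points where `c < h` only, and contains all such points of the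
interior and of the frontier. -/
def superlevelNhd (V : Set ℂ) (h : ℂ → ℝ) (c : ℝ) : Set ℂ :=
  {x ∈ interior V | c < h x} ∪ ⋃ a ∈ {x ∈ frontier V | c < h x},
    Metric.ball a (Metric.infDist a {x ∈ V | h x ≤ c} / 2)

theorem isOpen_superlevelNhd {V : Set ℂ} {h : ℂ → ℝ} (hc : ContinuousOn h V) (c : ℝ) :
    IsOpen (superlevelNhd V h c) :=
  ((hc.mono interior_subset).isOpen_inter_preimage isOpen_interior isOpen_Ioi).union
    (isOpen_biUnion fun _ _ => Metric.isOpen_ball)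

theorem lt_of_mem_superlevelNhd {V : Set ℂ} {h : ℂ → ℝ} {c : ℝ} {x : ℂ}
    (hx : x ∈ superlevelNhd V h c) (hxV : x ∈ V) : c < h x := by
  rcases hx with hx | hx
  · exact hx.2
  · obtain ⟨a, -, hx⟩ := mem_iUnion₂.1 hx
    by_contra! hle
    have h1 := Metric.infDist_le_dist_of_mem (x := a) (show x ∈ {x ∈ V | h x ≤ c} from ⟨hxV, hle⟩)
    rw [Metric.mem_ball, dist_comm] at hx
    linarith [dist_nonneg (x := a) (y := x)]

theorem disjoint_superlevelNhd {V : Set ℂ} (hV : IsClosed V) {h : ℂ → ℝ} {c : ℝ} :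
    Disjoint (superlevelNhd V h c) (superlevelNhd V (-h) (-c)) := by
  rw [disjoint_left]
  rintro x hx hx'
  by_cases hxV : x ∈ V
  · have h1 := lt_of_mem_superlevelNhd hx hxV
    have h2 := lt_of_mem_superlevelNhd hx' hxV
    simp at h2
    linarith
  · rcases hx with hx | hx
    · exact hxV (interior_subset hx.1)
    rcases hx' with hx' | hx'
    · exact hxV (interior_subset hx'.1)
    obtain ⟨a, ha, hx⟩ := mem_iUnion₂.1 hx
    obtain ⟨b, hb, hx'⟩ := mem_iUnion₂.1 hx'
    simp only [mem_ofPred_eq, Pi.neg_apply, neg_lt_neg_iff] at ha hb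
    have h1 := Metric.infDist_le_dist_of_mem (x := a)
      (show b ∈ {x ∈ V | h x ≤ c} from ⟨hV.frontier_subset hb.1, hb.2.le⟩)
    have h2 := Metric.infDist_le_dist_of_mem (x := b)
      (show a ∈ {x ∈ V | (-h) x ≤ -c} from ⟨hV.frontier_subset ha.1, by simpa using ha.2.le⟩)
    rw [Metric.mem_ball] at hx hx'
    rw [dist_comm b a] at h2
    have h3 := dist_triangle_left a b x
    linarith

theorem mem_superlevelNhd_of_mem_frontier {V : Set ℂ} (hV : IsClosed V) {h : ℂ → ℝ}
    (hc : ContinuousOn h V) {c : ℝ} (hne : {x ∈ V | h x ≤ c}.Nonempty) {a : ℂ}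
    (ha : a ∈ {x ∈ frontier V | c < h x}) :
    0 < Metric.infDist a {x ∈ V | h x ≤ c} / 2 := by
  have : IsClosed {x ∈ V | h x ≤ c} := hc.preimage_isClosed_of_isClosed hV isClosed_Iic
  exact half_pos ((this.notMem_iff_infDist_pos hne).1 fun h' => h'.2.not_gt ha.2)

open InnerProductSpace in
theorem isPreconnected_superlevelNhd {V : Set ℂ} (hV : IsCompact V) {h : ℂ → ℝ}
    (hc : ContinuousOn h V) (hh : HarmonicOnNhd h (interior V)) {c : ℝ}
    (hne : {x ∈ V | h x ≤ c}.Nonempty) (hA : IsPreconnected {x ∈ frontier V | c < h x}) :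
    IsPreconnected (superlevelNhd V h c) := by
  set A := {x ∈ frontier V | c < h x} with hAdef
  have hpos := fun a (ha : a ∈ A) => mem_superlevelNhd_of_mem_frontier hV.isClosed hc hne ha
  have hAP : A ⊆ superlevelNhd V h c := fun a ha =>
    Or.inr (mem_biUnion ha (Metric.mem_ball_self (hpos a ha)))
  have key : ∀ y ∈ superlevelNhd V h c, ∃ T ⊆ superlevelNhd V h c, y ∈ T ∧ A ⊆ T ∧
      IsPreconnected T ∧ A.Nonempty := by
    rintro y (hy | hy)
    · set U := {x ∈ interior V | c < h x} with hU
      have hUo : IsOpen U :=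
        (hc.mono interior_subset).isOpen_inter_preimage isOpen_interior isOpen_Ioi
      set C := connectedComponentIn U y with hC
      have hCo : IsOpen C := hUo.connectedComponentIn
      have hCU : C ⊆ U := connectedComponentIn_subset U y
      have hyC : y ∈ C := mem_connectedComponentIn hy
      have hCV : C ⊆ V := fun x hx => interior_subset (hCU hx).1
      have hclV : closure C ⊆ V := hV.isClosed.closure_subset_iff.2 hCV
      obtain ⟨a, haf, hac⟩ : ∃ a ∈ frontier C, c < h a := by
        by_contra! hcon
        exact (le_of_forall_frontier_le hCo (hV.isBounded.subset hCV) (hc.mono hclV)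
          (fun x hx => hh x (hCU hx).1) hcon y hyC).not_gt hy.2
      have hins : IsPreconnected (insert a C) :=
        isPreconnected_connectedComponentIn.subset_closure (subset_insert _ _)
          (insert_subset (frontier_subset_closure haf) subset_closure)
      have haA : a ∈ A := by
        refine ⟨⟨subset_closure (hclV (frontier_subset_closure haf)), fun hai => ?_⟩, hac⟩
        have : a ∈ C := mem_connectedComponentIn_of_mem_closure (show a ∈ U from ⟨hai, hac⟩)
          (frontier_subset_closure haf)
        rw [hCo.frontier_eq] at haf
        exact haf.2 this
      exact ⟨A ∪ insert a C,
        union_subset hAP (insert_subset (hAP haA) fun x hx => Or.inl (hCU hx)),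
        Or.inr (mem_insert_of_mem _ hyC), subset_union_left,
        hA.union a haA (mem_insert _ _) hins, a, haA⟩
    · obtain ⟨a, ha, hy⟩ := mem_iUnion₂.1 hy
      exact ⟨A ∪ Metric.ball a _,
        union_subset hAP fun x hx => Or.inr (mem_biUnion ha hx), Or.inr hy, subset_union_left,
        hA.union a ha (Metric.mem_ball_self (hpos a ha)) (convex_ball a _).isPreconnected, a, ha⟩
  refine isPreconnected_of_forall_pair fun x hx y hy => ?_
  obtain ⟨S, hSP, hxS, hAS, hS, a, ha⟩ := key x hx
  obtain ⟨T, hTP, hyT, hAT, hT, -⟩ := key y hy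
  exact ⟨S ∪ T, union_subset hSP hTP, Or.inl hxS, Or.inr hyT, hS.union a (hAS ha) (hAT ha) hT⟩

open InnerProductSpace in
/-- A harmonic function whose strict super- and sublevel sets at the value `h z` meet the frontier
in connected sets has no critical point at `z` unless it is locally constant there. -/
theorem InnerProductSpace.HarmonicOnNhd.eventually_eq_of_fderiv_eq_zero {V : Set ℂ}
    (hV : IsCompact V) {h : ℂ → ℝ} (hc : ContinuousOn h V) (hh : HarmonicOnNhd h (interior V))
    {z : ℂ} (hz : z ∈ interior V) (hd : fderiv ℝ h z = 0)
    (hA : IsPreconnected {x ∈ frontier V | h z < h x})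
    (hB : IsPreconnected {x ∈ frontier V | h x < h z}) : ∀ᶠ x in 𝓝 z, h x = h z := by
  by_contra hne
  obtain ⟨m, hm, u, ζ, hu, hζ, hev⟩ := (hh z hz).exists_alternating_rays hd hne
  have hzV := interior_subset hz
  have hc' : ContinuousOn (-h) V := hc.neg
  have hh' : HarmonicOnNhd (-h) (interior V) := fun x hx => (hh x hx).neg
  have hmem : ∀ w : ℂ, ∀ᶠ t : ℝ in 𝓝[>] 0, z + t * w ∈ interior V := fun w =>
    (tendsto_nhdsWithin_of_tendsto_nhds
      ((by fun_prop : Continuous fun t : ℝ => z + t * w).tendsto' 0 z (by simp))).eventually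
      (isOpen_interior.mem_nhds hz)
  refine false_of_alternating_rays (isOpen_superlevelNhd hc (h z))
    (isPreconnected_superlevelNhd hV hc hh ⟨z, hzV, le_rfl⟩ hA)
    (isOpen_superlevelNhd hc' (-h z))
    (isPreconnected_superlevelNhd hV hc' hh' ⟨z, hzV, le_rfl⟩ (by simpa using hB))
    (disjoint_superlevelNhd hV.isClosed) (fun h' => lt_irrefl _ (lt_of_mem_superlevelNhd h' hzV))
    (fun h' => lt_irrefl _ (lt_of_mem_superlevelNhd h' hzV)) hm hu hζ ?_
  filter_upwards [hev, hmem (u * (starRingEnd ℂ) ζ), hmem (u * ζ), hmem u, hmem (u * ζ ^ 2)]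
    with t ⟨h1, h2, h3, h4⟩ i1 i2 i3 i4
  exact ⟨Or.inl ⟨i1, h1⟩, Or.inl ⟨i2, h2⟩, Or.inl ⟨i3, neg_lt_neg h3⟩, Or.inl ⟨i4, neg_lt_neg h4⟩⟩

section Convex

variable {E : Type*} [NormedAddCommGroup E] [NormedSpace ℝ E] {W : Set E} {y₀ : E}

theorem Convex.add_inv_gauge_smul_mem_frontier (hW : Convex ℝ W) (hy₀ : y₀ ∈ interior W) {u : E}
    (hu : 0 < gauge ((fun x => y₀ + x) ⁻¹' W) u) :
    y₀ + (gauge ((fun x => y₀ + x) ⁻¹' W) u)⁻¹ • u ∈ frontier W := by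
  have h0 : (fun x => y₀ + x) ⁻¹' W ∈ 𝓝 0 :=
    (by fun_prop : Continuous fun x => y₀ + x).continuousAt.preimage_mem_nhds
      (by simpa using mem_interior_iff_mem_nhds.1 hy₀)
  have h1 := gauge_eq_one_iff_mem_frontier (x := (gauge ((fun x => y₀ + x) ⁻¹' W) u)⁻¹ • u)
    (hW.translate_preimage_right y₀) h0
  rw [gauge_smul_of_nonneg (inv_nonneg.2 (gauge_nonneg _)), smul_eq_mul,
    inv_mul_cancel₀ hu.ne'] at h1
  have h2 : frontier ((fun x => y₀ + x) ⁻¹' W) = (fun x => y₀ + x) ⁻¹' frontier W :=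
    ((Homeomorph.addLeft y₀).preimage_frontier W).symm
  rw [h2] at h1
  exact h1.1 rfl

theorem gauge_preimage_add_pos (hb : Bornology.IsBounded W) (hy₀ : y₀ ∈ interior W)
    {u : E} (hu : u ≠ 0) : 0 < gauge ((fun x => y₀ + x) ⁻¹' W) u := by
  have h0 : (fun x => y₀ + x) ⁻¹' W ∈ 𝓝 0 :=
    (by fun_prop : Continuous fun x => y₀ + x).continuousAt.preimage_mem_nhds
      (by simpa using mem_interior_iff_mem_nhds.1 hy₀)
  refine (gauge_pos (absorbent_nhds_zero h0) ?_).2 hu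
  rw [NormedSpace.isVonNBounded_iff]
  exact (IsometryEquiv.addLeft y₀).isometry.antilipschitz.isBounded_preimage hb

theorem Convex.exists_mem_frontier_lt (hW : Convex ℝ W) (hb : Bornology.IsBounded W)
    (hy₀ : y₀ ∈ interior W) {l : E →L[ℝ] ℝ} (hl : l ≠ 0) : ∃ y ∈ frontier W, l y₀ < l y := by
  obtain ⟨u, hu⟩ : ∃ u, 0 < l u := by
    obtain ⟨u, hu⟩ := DFunLike.ne_iff.1 hl
    rcases lt_or_gt_of_ne hu with h | h
    · exact ⟨-u, by simpa using h⟩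
    · exact ⟨u, h⟩
  have hg := gauge_preimage_add_pos hb hy₀ (u := u) (by rintro rfl; simp at hu)
  refine ⟨_, hW.add_inv_gauge_smul_mem_frontier hy₀ hg, ?_⟩
  simp only [map_add, map_smul, smul_eq_mul]
  have := mul_pos (inv_pos.2 hg) hu
  linarith

theorem Convex.isPreconnected_frontier_inter_halfspace (hW : Convex ℝ W)
    (hb : Bornology.IsBounded W) (hy₀ : y₀ ∈ interior W) (l : E →L[ℝ] ℝ) :
    IsPreconnected {y ∈ frontier W | l y₀ < l y} := by
  set g := gauge ((fun x => y₀ + x) ⁻¹' W) with hg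
  have h0 : (fun x => y₀ + x) ⁻¹' W ∈ 𝓝 0 :=
    (by fun_prop : Continuous fun x => y₀ + x).continuousAt.preimage_mem_nhds
      (by simpa using mem_interior_iff_mem_nhds.1 hy₀)
  have hgc : Continuous g := continuous_gauge (hW.translate_preimage_right y₀) h0
  have hpos : ∀ u, 0 < l u → 0 < g u := fun u hu =>
    gauge_preimage_add_pos hb hy₀ (by rintro rfl; simp at hu)
  have himg : {y ∈ frontier W | l y₀ < l y} = (fun u => y₀ + (g u)⁻¹ • u) '' {u | 0 < l u} := by
    ext y
    constructor
    · rintro ⟨hy, hly⟩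
      refine ⟨y - y₀, by simpa using hly, ?_⟩
      have h2 : frontier ((fun x => y₀ + x) ⁻¹' W) = (fun x => y₀ + x) ⁻¹' frontier W :=
        ((Homeomorph.addLeft y₀).preimage_frontier W).symm
      have : g (y - y₀) = 1 :=
        (gauge_eq_one_iff_mem_frontier (hW.translate_preimage_right y₀) h0).2
          (by rw [h2]; simpa using hy)
      simp [this]
    · rintro ⟨u, hu, rfl⟩
      refine ⟨hW.add_inv_gauge_smul_mem_frontier hy₀ (hpos u hu), ?_⟩
      simp only [map_add, map_smul, smul_eq_mul]
      have := mul_pos (inv_pos.2 (hpos u hu)) hu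
      linarith
  rw [himg]
  refine (convex_halfSpace_gt l.toLinearMap.isLinear 0).isPreconnected.image _ ?_
  exact continuousOn_const.add ((hgc.continuousOn.inv₀ fun u hu => (hpos u hu).ne').smul
    continuousOn_id)

end Convex

theorem IsPreconnected.inter_preimage_of_isCompact {X Y : Type*} [TopologicalSpace X]
    [TopologicalSpace Y] [T2Space Y] {K : Set X} {f : X → Y} {S : Set Y} (hS : IsPreconnected S)
    (hK : IsCompact K) (hf : ContinuousOn f K) (hinj : InjOn f K) (hSK : S ⊆ f '' K) :
    IsPreconnected (K ∩ f ⁻¹' S) := by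
  have := isCompact_iff_compactSpace.1 hK
  have h1 : Continuous (K.domRestrict f) := continuousOn_iff_continuous_domRestrict.1 hf
  have h2 := (hS.preimage_of_isClosedMap (injOn_iff_injective.1 hinj) h1.isClosedMap
    (by rwa [range_domRestrict])).image _ continuous_subtype_val.continuousOn
  convert h2 using 1
  ext x
  simp [and_comm]

theorem frontier_connectedComponentIn_interior_subset {X : Type*} [TopologicalSpace X]
    [LocallyConnectedSpace X] (V : Set X) (z : X) :
    frontier (connectedComponentIn (interior V) z) ⊆ frontier V := by
  intro x hx
  have hcl := frontier_subset_closure hx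
  refine ⟨closure_mono ((connectedComponentIn_subset _ _).trans interior_subset) hcl, fun hxi => ?_⟩
  rw [(isOpen_interior.connectedComponentIn).frontier_eq] at hx
  exact hx.2 (mem_connectedComponentIn_of_mem_closure hxi hcl)

open InnerProductSpace in
/-- A continuous map from the closure of a Jordan domain, with boundary parametrization `γ`, to a
compact convex set, harmonic inside and mapping boundary homeomorphically to boundary. -/
structure IsKneserMap (V : Set ℂ) (γ : ℝ → ℂ) (W : Set (ℝ × ℝ)) (F : ℂ → ℝ × ℝ) : Prop where
  isCompact_source : IsCompact V
  closure_interior_source : closure (interior V) = V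
  continuous_param : Continuous γ
  periodic_param : Function.Periodic γ 1
  injOn_param : InjOn γ (Ico 0 1)
  image_param : γ '' Ico 0 1 = frontier V
  isCompact_target : IsCompact W
  convex_target : Convex ℝ W
  nonempty_interior_target : (interior W).Nonempty
  continuousOn : ContinuousOn F V
  mapsTo : MapsTo F V W
  bijOn_frontier : BijOn F (frontier V) (frontier W)
  harmonicOnNhd : ∀ l : ℝ × ℝ →L[ℝ] ℝ, HarmonicOnNhd (fun x => l (F x)) (interior V)

namespace IsKneserMap

variable {V C : Set ℂ} {γ : ℝ → ℂ} {W : Set (ℝ × ℝ)} {F : ℂ → ℝ × ℝ}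

theorem frontier_subset (K : IsKneserMap V γ W F) : frontier V ⊆ V :=
  K.isCompact_source.isClosed.frontier_subset

theorem param_mem_frontier (K : IsKneserMap V γ W F) (t : ℝ) : γ t ∈ frontier V := by
  obtain ⟨s, hs, hst⟩ := K.periodic_param.exists_mem_Ico₀ one_pos t
  rw [hst, ← K.image_param]
  exact mem_image_of_mem γ hs

theorem injOn_param_Ico (K : IsKneserMap V γ W F) (a : ℝ) : InjOn γ (Ico a (a + 1)) := by
  intro s hs t ht hst
  have h1 : ∀ x, γ (Int.fract x) = γ x := fun x => by
    have := K.periodic_param.sub_zsmul_eq (x := x) ⌊x⌋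
    rwa [zsmul_one] at this
  have h2 : Int.fract s = Int.fract t :=
    K.injOn_param ⟨Int.fract_nonneg _, Int.fract_lt_one _⟩
      ⟨Int.fract_nonneg _, Int.fract_lt_one _⟩ (by rw [h1, h1, hst])
  obtain ⟨k, hk⟩ := Int.fract_eq_fract.1 h2
  have h3 : (k : ℝ) < 1 := by rw [← hk]; linarith [hs.2, ht.1]
  have h4 : (-1 : ℝ) < k := by rw [← hk]; linarith [hs.1, ht.2]
  have h5 : k = 0 := by
    have h3' : k < 1 := by exact_mod_cast h3
    have h4' : -1 < k := by exact_mod_cast h4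
    omega
  rw [h5] at hk
  simp at hk
  linarith

/-- The frontier of an open subset cannot be mapped into a line. -/
theorem not_frontier_subset_level (K : IsKneserMap V γ W F) (hC : C.Nonempty)
    (hCV : C ⊆ interior V) (hCf : frontier C ⊆ frontier V) {l : ℝ × ℝ →L[ℝ] ℝ} (hl : l ≠ 0)
    (c : ℝ) : ¬ ∀ x ∈ frontier C, l (F x) = c := by
  intro hc
  obtain ⟨y₀, hy₀⟩ := K.nonempty_interior_target
  obtain ⟨y, hy, hyc⟩ : ∃ y ∈ frontier W, l y ≠ c := by
    obtain ⟨y, hy, h1⟩ :=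
      K.convex_target.exists_mem_frontier_lt K.isCompact_target.isBounded hy₀ hl
    obtain ⟨y', hy', h2⟩ := K.convex_target.exists_mem_frontier_lt K.isCompact_target.isBounded
      hy₀ (neg_ne_zero.2 hl)
    simp at h2
    by_cases h : l y = c
    · exact ⟨y', hy', by linarith⟩
    · exact ⟨y, hy, h⟩
  obtain ⟨x, hx, rfl⟩ := K.bijOn_frontier.surjOn hy
  rw [← K.image_param] at hx
  obtain ⟨t₀, -, rfl⟩ := hx
  have hcont : Continuous fun t => l (F (γ t)) :=
    l.continuous.comp (K.continuousOn.comp_continuous K.continuous_param fun t =>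
      K.frontier_subset (K.param_mem_frontier t))
  obtain ⟨ε, hε, hball⟩ := Metric.isOpen_iff.1 (isOpen_ne_fun hcont continuous_const) t₀ hyc
  have hfar : ∀ t, l (F (γ t)) = c → ε ≤ |t - t₀| := by
    intro t ht
    by_contra! h
    exact hball (by rwa [Metric.mem_ball, Real.dist_eq]) ht
  have hsub : frontier C ⊆ γ '' Icc (t₀ + ε) (t₀ + 1 - ε) := by
    intro x hx
    have hxV := hCf hx
    rw [← K.image_param] at hxV
    obtain ⟨s, -, rfl⟩ := hxV
    obtain ⟨t, ht, hst⟩ := K.periodic_param.exists_mem_Ico one_pos s t₀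
    refine ⟨t, ?_, hst.symm⟩
    have h1 := hc _ hx
    have h2 : l (F (γ (t - 1))) = c := by rw [K.periodic_param.sub_eq, ← hst, h1]
    have h3 := hfar _ h2
    have h4 := hfar t (by rw [← hst, h1])
    rw [abs_of_nonneg (by linarith [ht.1])] at h4
    rw [abs_of_nonpos (by linarith [ht.2])] at h3
    exact ⟨by linarith, by linarith⟩
  refine not_frontier_subset_arc (K.isCompact_source.isBounded.subset (hCV.trans interior_subset))
    hC K.continuous_param.continuousOn ((K.injOn_param_Ico t₀).mono fun t ht =>
      mem_Ico.2 ⟨by linarith [ht.1], by linarith [ht.2]⟩) ?_ hsub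
  rw [disjoint_left]
  rintro _ hx ⟨t, -, rfl⟩
  exact (K.param_mem_frontier t).2 (hCV hx)

theorem not_eventually_eq (K : IsKneserMap V γ W F) {z : ℂ} (hz : z ∈ interior V)
    {l : ℝ × ℝ →L[ℝ] ℝ} (hl : l ≠ 0) : ¬ ∀ᶠ x in 𝓝 z, l (F x) = l (F z) := by
  intro hev
  have hsub := connectedComponentIn_subset (interior V) z
  have hzC := mem_connectedComponentIn hz
  have hconst := eqOn_const_of_isPreconnected_of_eventuallyEq
    (fun x hx => K.harmonicOnNhd l x (hsub hx)) isPreconnected_connectedComponentIn hzC hev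
  refine K.not_frontier_subset_level ⟨z, hzC⟩ hsub
    (frontier_connectedComponentIn_interior_subset V z) hl
    (l (F z)) fun x hx => ?_
  have hclV : closure (connectedComponentIn (interior V) z) ⊆ V :=
    K.isCompact_source.isClosed.closure_subset_iff.2 (hsub.trans interior_subset)
  have h1 : ContinuousOn (fun x => l (F x)) (closure (connectedComponentIn (interior V) z)) :=
    l.continuous.comp_continuousOn (K.continuousOn.mono hclV)
  exact (show EqOn (fun x => l (F x)) (fun _ => l (F z)) _ from hconst).of_subset_closure h1
    continuousOn_const subset_closure Subset.rfl (frontier_subset_closure hx)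

theorem mapsTo_interior (K : IsKneserMap V γ W F) : MapsTo F (interior V) (interior W) := by
  intro z hz
  by_contra hzW
  obtain ⟨l, hl⟩ := geometric_hahn_banach_open_point K.convex_target.interior isOpen_interior hzW
  obtain ⟨y₀, hy₀⟩ := K.nonempty_interior_target
  have hl0 : l ≠ 0 := by
    rintro rfl
    simpa using hl y₀ hy₀
  have hle : ∀ y ∈ W, l y ≤ l (F z) := fun y hy => by
    have hy' := subset_closure hy
    rw [← K.convex_target.closure_interior_eq_closure_of_nonempty_interior ⟨y₀, hy₀⟩] at hy'
    exact le_on_closure (fun x hx => (hl x hx).le) l.continuous.continuousOn continuousOn_const hy'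
  refine K.not_eventually_eq hz hl0 ((K.harmonicOnNhd l z hz).eventually_eq_of_isLocalMax ?_)
  filter_upwards [isOpen_interior.mem_nhds hz] with x hx
  exact hle _ (K.mapsTo (interior_subset hx))

theorem isPreconnected_frontier_inter (K : IsKneserMap V γ W F) {y₀ : ℝ × ℝ}
    (hy₀ : y₀ ∈ interior W) (l : ℝ × ℝ →L[ℝ] ℝ) :
    IsPreconnected {x ∈ frontier V | l y₀ < l (F x)} := by
  have h := (K.convex_target.isPreconnected_frontier_inter_halfspace K.isCompact_target.isBounded
    hy₀ l).inter_preimage_of_isCompact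
      (K.isCompact_source.of_isClosed_subset isClosed_frontier K.frontier_subset)
      (K.continuousOn.mono K.frontier_subset) K.bijOn_frontier.injOn
      (by rw [K.bijOn_frontier.image_eq]; exact fun y hy => hy.1)
  convert h using 1
  ext x
  exact ⟨fun hx => ⟨hx.1, K.bijOn_frontier.mapsTo hx.1, hx.2⟩, fun hx => ⟨hx.1, hx.2.2⟩⟩

theorem contDiffAt (K : IsKneserMap V γ W F) {z : ℂ} (hz : z ∈ interior V) :
    ContDiffAt ℝ 2 F z :=
  (K.harmonicOnNhd (.fst ℝ ℝ ℝ) z hz).1.prodMk (K.harmonicOnNhd (.snd ℝ ℝ ℝ) z hz).1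

theorem comp_fderiv_ne_zero (K : IsKneserMap V γ W F) {z : ℂ} (hz : z ∈ interior V)
    {l : ℝ × ℝ →L[ℝ] ℝ} (hl : l ≠ 0) : l.comp (fderiv ℝ F z) ≠ 0 := by
  intro h0
  refine K.not_eventually_eq hz hl ((K.harmonicOnNhd l).eventually_eq_of_fderiv_eq_zero
    K.isCompact_source (l.continuous.comp_continuousOn K.continuousOn) hz ?_
    (K.isPreconnected_frontier_inter (K.mapsTo_interior hz) l) ?_)
  · rw [← h0]
    exact (l.hasFDerivAt.comp z
      ((K.contDiffAt hz).differentiableAt two_ne_zero).hasFDerivAt).fderiv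
  · simpa using K.isPreconnected_frontier_inter (K.mapsTo_interior hz) (-l)

theorem exists_hasStrictFDerivAt_equiv (K : IsKneserMap V γ W F) {z : ℂ} (hz : z ∈ interior V) :
    ∃ e : ℂ ≃L[ℝ] ℝ × ℝ, HasStrictFDerivAt F (e : ℂ →L[ℝ] ℝ × ℝ) z := by
  have hrank : Module.finrank ℝ ℂ = Module.finrank ℝ (ℝ × ℝ) := by simp
  have hsurj : Function.Surjective (fderiv ℝ F z) := by
    by_contra hns
    have hlt : (fderiv ℝ F z).range < ⊤ :=
      lt_top_iff_ne_top.2 fun h => hns (LinearMap.range_eq_top.1 h)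
    obtain ⟨l, hl0, hl⟩ := Submodule.exists_le_ker_of_lt_top _ hlt
    refine K.comp_fderiv_ne_zero hz (l := LinearMap.toContinuousLinearMap l) (by simpa using hl0) ?_
    ext1 x
    exact hl ⟨x, rfl⟩
  have hinj : Function.Injective (fderiv ℝ F z : ℂ →ₗ[ℝ] ℝ × ℝ) :=
    (LinearMap.injective_iff_surjective_of_finrank_eq_finrank hrank).2 hsurj
  refine ⟨(LinearMap.linearEquivOfInjective _ hinj hrank).toContinuousLinearEquiv, ?_⟩
  exact (K.contDiffAt hz).hasStrictFDerivAt two_ne_zero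

end IsKneserMap

theorem IsOpen.exists_apply_ne {E : Type*} [NormedAddCommGroup E] [NormedSpace ℝ E] {O : Set E}
    (hO : IsOpen O) (hne : O.Nonempty) {l : E →L[ℝ] ℝ} (hl : l ≠ 0) (c : ℝ) :
    ∃ x ∈ O, l x ≠ c := by
  by_contra! h
  obtain ⟨x, hx⟩ := hne
  refine hl (ContinuousLinearMap.ext fun u => ?_)
  have h1 : HasFDerivAt (fun _ : E => c) l x := l.hasFDerivAt.congr_of_eventuallyEq (by
    filter_upwards [hO.mem_nhds hx] with y hy using (h y hy).symm)
  rw [h1.unique (hasFDerivAt_const c x)]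

namespace IsKneserMap

variable {V C : Set ℂ} {γ : ℝ → ℂ} {W : Set (ℝ × ℝ)} {F : ℂ → ℝ × ℝ}

theorem map_nhds_eq (K : IsKneserMap V γ W F) {z : ℂ} (hz : z ∈ interior V) :
    map F (𝓝 z) = 𝓝 (F z) := by
  obtain ⟨e, he⟩ := K.exists_hasStrictFDerivAt_equiv hz
  exact he.map_nhds_eq_of_equiv

theorem image_connectedComponentIn (K : IsKneserMap V γ W F) {z : ℂ} (hz : z ∈ interior V) :
    F '' connectedComponentIn (interior V) z = interior W := by
  set C := connectedComponentIn (interior V) z with hC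
  have hsub : C ⊆ interior V := connectedComponentIn_subset _ _
  have hCo : IsOpen C := isOpen_interior.connectedComponentIn
  have hclV : closure C ⊆ V :=
    K.isCompact_source.isClosed.closure_subset_iff.2 (hsub.trans interior_subset)
  refine Subset.antisymm (K.mapsTo_interior.mono_left hsub).image_subset ?_
  have hopen : IsOpen (F '' C) := by
    refine isOpen_iff_mem_nhds.2 ?_
    rintro _ ⟨x, hx, rfl⟩
    rw [← K.map_nhds_eq (hsub hx)]
    exact image_mem_map (hCo.mem_nhds hx)
  refine K.convex_target.interior.isPreconnected.subset_of_closure_inter_subset hopen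
    ⟨F z, K.mapsTo_interior hz, mem_image_of_mem F (mem_connectedComponentIn hz)⟩ ?_
  rintro y ⟨hy, hyW⟩
  have hcl : closure (F '' C) ⊆ F '' closure C :=
    closure_minimal (image_mono subset_closure)
      ((K.isCompact_source.of_isClosed_subset isClosed_closure hclV).image_of_continuousOn
        (K.continuousOn.mono hclV)).isClosed
  obtain ⟨x, hx, rfl⟩ := hcl hy
  refine mem_image_of_mem F (mem_connectedComponentIn_of_mem_closure ?_ hx)
  by_contra hxi
  exact (K.bijOn_frontier.mapsTo ⟨subset_closure (hclV hx), hxi⟩).2 hyW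

theorem frontier_subset_closure_connectedComponentIn (K : IsKneserMap V γ W F) {z : ℂ}
    (hz : z ∈ interior V) : frontier V ⊆ closure (connectedComponentIn (interior V) z) := by
  intro p hp
  set C := connectedComponentIn (interior V) z with hC
  have hclV : closure C ⊆ V := K.isCompact_source.isClosed.closure_subset_iff.2
    ((connectedComponentIn_subset _ _).trans interior_subset)
  have hW : W ⊆ F '' closure C := by
    refine subset_closure.trans ?_
    rw [← K.convex_target.closure_interior_eq_closure_of_nonempty_interior
      K.nonempty_interior_target, ← K.image_connectedComponentIn hz]
    exact closure_minimal (image_mono subset_closure)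
      ((K.isCompact_source.of_isClosed_subset isClosed_closure hclV).image_of_continuousOn
        (K.continuousOn.mono hclV)).isClosed
  obtain ⟨x, hx, hxp⟩ := hW (K.mapsTo (K.frontier_subset hp))
  have hxf : x ∈ frontier V := by
    refine ⟨subset_closure (hclV hx), fun hxi => ?_⟩
    have := K.mapsTo_interior hxi
    rw [hxp] at this
    exact (K.bijOn_frontier.mapsTo hp).2 this
  rwa [← K.bijOn_frontier.injOn hxf hp hxp]

/-- The source is connected as soon as its boundary is flat somewhere. -/
theorem isPreconnected_interior (K : IsKneserMap V γ W F) {p : ℂ} (hp : p ∈ frontier V) {r : ℝ}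
    (hr : 0 < r) {l : ℂ →L[ℝ] ℝ} (hl : l ≠ 0) {c : ℝ}
    (hflat : ∀ x ∈ Metric.ball p r, x ∈ frontier V → l x = c) :
    IsPreconnected (interior V) := by
  have hside : ∀ H : Set ℂ, IsPreconnected H → H ⊆ Metric.ball p r → (∀ x ∈ H, l x ≠ c) →
      ∀ x ∈ H, x ∈ interior V → H ⊆ interior V := by
    intro H hH hHb hHc x hxH hxV
    refine hH.subset_of_closure_inter_subset isOpen_interior ⟨x, hxH, hxV⟩ ?_
    rintro y ⟨hyV, hyH⟩
    by_contra hyi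
    rw [K.closure_interior_source] at hyV
    exact hHc y hyH (hflat y (hHb hyH) ⟨subset_closure hyV, hyi⟩)
  set P := Metric.ball p r ∩ {x | c < l x} with hP
  set N := Metric.ball p r ∩ {x | l x < c} with hN
  have hPc : IsPreconnected P := ((convex_ball p r).inter
    (convex_halfSpace_gt l.toLinearMap.isLinear c)).isPreconnected
  have hNc : IsPreconnected N := ((convex_ball p r).inter
    (convex_halfSpace_lt l.toLinearMap.isLinear c)).isPreconnected
  have hnot : ¬ (P ⊆ interior V ∧ N ⊆ interior V) := by
    rintro ⟨hPV, hNV⟩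
    refine hp.2 (mem_interior.2 ⟨_, ?_, Metric.isOpen_ball, Metric.mem_ball_self hr⟩)
    intro x hx
    by_contra hxV
    obtain ⟨y, ⟨hyb, hyV⟩, hyc⟩ := (Metric.isOpen_ball.inter
      K.isCompact_source.isClosed.isOpen_compl).exists_apply_ne ⟨x, hx, hxV⟩ hl c
    rcases lt_or_gt_of_ne hyc with h | h
    · exact hyV (interior_subset (hNV ⟨hyb, h⟩))
    · exact hyV (interior_subset (hPV ⟨hyb, h⟩))
  have hex : ∀ z ∈ interior V, ∃ x ∈ connectedComponentIn (interior V) z, x ∈ P ∨ x ∈ N := by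
    intro z hz
    obtain ⟨x, hx, hxC⟩ := mem_closure_iff.1 (K.frontier_subset_closure_connectedComponentIn hz hp)
      _ Metric.isOpen_ball (Metric.mem_ball_self hr)
    obtain ⟨y, ⟨hyb, hyC⟩, hyc⟩ := (Metric.isOpen_ball.inter
      isOpen_interior.connectedComponentIn).exists_apply_ne ⟨x, hx, hxC⟩ hl c
    rcases lt_or_gt_of_ne hyc with h | h
    · exact ⟨y, hyC, Or.inr ⟨hyb, h⟩⟩
    · exact ⟨y, hyC, Or.inl ⟨hyb, h⟩⟩
  have hsame : ∀ H : Set ℂ, IsPreconnected H → H ⊆ interior V → ∀ z₁ z₂ x₁ x₂,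
      z₁ ∈ interior V → z₂ ∈ interior V →
      x₁ ∈ connectedComponentIn (interior V) z₁ → x₂ ∈ connectedComponentIn (interior V) z₂ →
      x₁ ∈ H → x₂ ∈ H → z₂ ∈ connectedComponentIn (interior V) z₁ := by
    intro H hH hHV z₁ z₂ x₁ x₂ hz₁ hz₂ h₁ h₂ hx₁ hx₂
    have h3 := hH.subset_connectedComponentIn hx₁ hHV hx₂
    rw [connectedComponentIn_eq h₁, connectedComponentIn_eq h3, ← connectedComponentIn_eq h₂]
    exact mem_connectedComponentIn hz₂
  refine isPreconnected_of_forall_pair fun z₁ hz₁ z₂ hz₂ =>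
    ⟨_, connectedComponentIn_subset (interior V) z₁, mem_connectedComponentIn hz₁, ?_,
      isPreconnected_connectedComponentIn⟩
  obtain ⟨x₁, h₁, hx₁⟩ := hex z₁ hz₁
  obtain ⟨x₂, h₂, hx₂⟩ := hex z₂ hz₂
  have hV₁ := connectedComponentIn_subset _ _ h₁
  have hV₂ := connectedComponentIn_subset _ _ h₂
  have hPV : ∀ x ∈ P, x ∈ interior V → P ⊆ interior V :=
    hside P hPc inter_subset_left fun x hx => hx.2.ne'
  have hNV : ∀ x ∈ N, x ∈ interior V → N ⊆ interior V :=
    hside N hNc inter_subset_left fun x hx => hx.2.ne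
  rcases hx₁ with hx₁ | hx₁ <;> rcases hx₂ with hx₂ | hx₂
  · exact hsame P hPc (hPV _ hx₁ hV₁) _ _ _ _ hz₁ hz₂ h₁ h₂ hx₁ hx₂
  · exact absurd ⟨hPV _ hx₁ hV₁, hNV _ hx₂ hV₂⟩ hnot
  · exact absurd ⟨hPV _ hx₂ hV₂, hNV _ hx₁ hV₁⟩ hnot
  · exact hsame N hNc (hNV _ hx₁ hV₁) _ _ _ _ hz₁ hz₂ h₁ h₂ hx₁ hx₂

theorem mem_interior_of_apply_mem_interior (K : IsKneserMap V γ W F) {x : ℂ} (hx : x ∈ V)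
    (hFx : F x ∈ interior W) : x ∈ interior V := by
  by_contra hxi
  exact (K.bijOn_frontier.mapsTo ⟨subset_closure hx, hxi⟩).2 hFx

theorem isCoveringMapOn_interior (K : IsKneserMap V γ W F) :
    IsCoveringMapOn (V.domRestrict F) (interior W) := by
  have := isCompact_iff_compactSpace.1 K.isCompact_source
  refine IsCoveringMapOn.of_isLocalHomeomorphOn
    (continuousOn_iff_continuous_domRestrict.1 K.continuousOn)
    ((isLocalHomeomorphOn_iff_isOpenEmbedding_restrict _).2 fun x hx => ?_)
  have hxi : (x : ℂ) ∈ interior V := K.mem_interior_of_apply_mem_interior x.2 hx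
  obtain ⟨e, he⟩ := K.exists_hasStrictFDerivAt_equiv hxi
  set φ := he.toOpenPartialHomeomorph F with hφ
  set S := φ.source ∩ interior V with hS
  have hSo : IsOpen S := φ.open_source.inter isOpen_interior
  refine ⟨Subtype.val ⁻¹' S, (hSo.preimage continuous_subtype_val).mem_nhds
    ⟨he.mem_toOpenPartialHomeomorph_source, hxi⟩,
    IsOpenEmbedding.of_continuous_injective_isOpenMap ?_ ?_ ?_⟩
  · exact (continuousOn_iff_continuous_domRestrict.1 K.continuousOn).comp continuous_subtype_val
  · intro a b hab
    exact Subtype.ext (Subtype.ext (φ.injOn a.2.1 b.2.1 hab))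
  · refine IsOpenMap.of_nhds_le fun a => ?_
    have hSV : S ⊆ V := inter_subset_right.trans interior_subset
    have h1 : map (fun a : (Subtype.val ⁻¹' S : Set V) => (a : ℂ)) (𝓝 a) = 𝓝 (a : ℂ) := by
      have h2 : map (Subtype.val : V → ℂ) (𝓝 a.1) = 𝓝 (a : ℂ) :=
        map_nhds_subtype_coe_eq_nhds a.1.2 (mem_of_superset (hSo.mem_nhds a.2) hSV)
      have h3 : map (Subtype.val : (Subtype.val ⁻¹' S : Set V) → V) (𝓝 a) = 𝓝 a.1 :=
        map_nhds_subtype_coe_eq_nhds a.2 ((hSo.preimage continuous_subtype_val).mem_nhds a.2)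
      rw [← h2, ← h3, map_map]
      rfl
    have h4 := K.map_nhds_eq (z := a) a.2.2
    rw [← h1, map_map] at h4
    exact h4.ge

theorem injOn_interior (K : IsKneserMap V γ W F) (hc : IsPreconnected (interior V)) :
    InjOn F (interior V) := by
  have hcov := K.isCoveringMapOn_interior.isCoveringMap_restrictPreimage
  have hpre : IsPreconnected (V.domRestrict F ⁻¹' interior W) := by
    rw [← IsInducing.subtypeVal.isPreconnected_image]
    convert hc using 1
    ext x
    constructor
    · rintro ⟨y, hy, rfl⟩
      exact K.mem_interior_of_apply_mem_interior y.2 hy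
    · exact fun hx => ⟨⟨x, interior_subset hx⟩, K.mapsTo_interior hx, rfl⟩
  have := isPreconnected_iff_preconnectedSpace.1 hpre
  have := K.convex_target.interior.contractibleSpace K.nonempty_interior_target
  have := K.convex_target.interior.locallyPathConnectedSpace
  intro x hx y hy hxy
  set a : V.domRestrict F ⁻¹' interior W :=
    ⟨⟨x, interior_subset hx⟩, K.mapsTo_interior hx⟩ with ha
  set b : V.domRestrict F ⁻¹' interior W :=
    ⟨⟨y, interior_subset hy⟩, K.mapsTo_interior hy⟩ with hb
  set p := (interior W).restrictPreimage (V.domRestrict F) with hp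
  obtain ⟨s, ⟨hs, hps⟩, -⟩ := hcov.existsUnique_continuousMap_lifts (ContinuousMap.id _) (p a) a rfl
  have hpab : p a = p b := Subtype.ext hxy
  have hsp : s ∘ p = id := hcov.eq_of_comp_eq (s.continuous.comp hcov.continuous) continuous_id
    (by rw [← Function.comp_assoc, hps]; rfl) a hs
  have hab : a = b := by
    have h1 := congr_fun hsp b
    simp only [Function.comp_apply, ← hpab, hs, id_eq] at h1
    exact h1
  exact congrArg (fun t : V.domRestrict F ⁻¹' interior W => (t.1 : ℂ)) hab

/-- The Radó–Kneser–Choquet theorem for a domain whose boundary is flat somewhere. -/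
theorem bijOn (K : IsKneserMap V γ W F) {p : ℂ} (hp : p ∈ frontier V) {r : ℝ}
    (hr : 0 < r) {l : ℂ →L[ℝ] ℝ} (hl : l ≠ 0) {c : ℝ}
    (hflat : ∀ x ∈ Metric.ball p r, x ∈ frontier V → l x = c) : BijOn F V W := by
  have hinj := K.injOn_interior (K.isPreconnected_interior hp hr hl hflat)
  have hV : V = interior V ∪ frontier V := by
    rw [← closure_eq_interior_union_frontier, K.isCompact_source.isClosed.closure_eq]
  have hW : W = interior W ∪ frontier W := by
    rw [← closure_eq_interior_union_frontier, K.isCompact_target.isClosed.closure_eq]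
  obtain ⟨z, hz⟩ : (interior V).Nonempty := by
    have := K.frontier_subset hp
    rw [← K.closure_interior_source] at this
    exact closure_nonempty_iff.1 ⟨p, this⟩
  refine ⟨K.mapsTo, ?_, ?_⟩
  · intro x hx y hy hxy
    by_cases hxi : x ∈ interior V
    · exact hinj hxi (K.mem_interior_of_apply_mem_interior hy (hxy ▸ K.mapsTo_interior hxi)) hxy
    · have hyi : y ∉ interior V := fun hyi =>
        hxi (K.mem_interior_of_apply_mem_interior hx (hxy ▸ K.mapsTo_interior hyi))
      exact K.bijOn_frontier.injOn ⟨subset_closure hx, hxi⟩ ⟨subset_closure hy, hyi⟩ hxy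
  · intro y hy
    rw [hW] at hy
    rcases hy with hy | hy
    · rw [← K.image_connectedComponentIn hz] at hy
      exact image_mono ((connectedComponentIn_subset _ _).trans interior_subset) hy
    · exact image_mono K.frontier_subset (K.bijOn_frontier.surjOn hy)

end IsKneserMap

theorem Set.BijOn.of_comp_eqOn {α β δ : Type*} {I : Set α} {A : Set β} {B : Set δ} {f : α → β}
    {g : α → δ} {F : β → δ} (hf : BijOn f I A) (hg : BijOn g I B) (h : EqOn (F ∘ f) g I) :
    BijOn F A B := by
  have hFf : BijOn (F ∘ f) I B := hg.congr h.symm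
  rw [← hf.image_eq]
  refine ⟨?_, ?_, ?_⟩
  · rintro _ ⟨t, ht, rfl⟩
    exact hFf.mapsTo ht
  · rintro _ ⟨s, hs, rfl⟩ _ ⟨t, ht, rfl⟩ hst
    rw [hFf.injOn hs ht hst]
  · intro y hy
    obtain ⟨t, ht, rfl⟩ := hFf.surjOn hy
    exact ⟨f t, mem_image_of_mem f ht, rfl⟩

section Harmonic

open InnerProductSpace

theorem laplacian_comp_equivRealProdCLM {u : ℝ × ℝ → ℝ} {z : ℂ}
    (h : ContDiffAt ℝ 2 u (Complex.equivRealProdCLM z)) :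
    Laplacian.laplacian (u ∘ Complex.equivRealProdCLM) z =
      lap2 u (Complex.equivRealProdCLM z) := by
  set e := Complex.equivRealProdCLM
  have hd : DifferentiableAt ℝ (fderiv ℝ (u ∘ e)) z :=
    ((h.comp z e.contDiff.contDiffAt).fderiv_right (m := 1) le_rfl).differentiableAt one_ne_zero
  have key : ∀ a b : ℂ, fderiv ℝ (fderiv ℝ (u ∘ e)) z a b =
      fderiv ℝ (fun q => fderiv ℝ u q (e b)) (e z) (e a) := by
    intro a b
    have h1 : fderiv ℝ (fun y => fderiv ℝ (u ∘ e) y b) z a =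
        fderiv ℝ (fderiv ℝ (u ∘ e)) z a b := by
      rw [fderiv_clm_apply hd (differentiableAt_const b)]
      simp
    have h2 : (fun y => fderiv ℝ (u ∘ e) y b) = (fun q => fderiv ℝ u q (e b)) ∘ e := by
      ext y
      rw [e.comp_right_fderiv]
      rfl
    rw [← h1, h2, e.comp_right_fderiv]
    rfl
  rw [laplacian_eq_iteratedFDeriv_complexPlane]
  simp only [iteratedFDeriv_two_apply]
  simp [key, lap2, e, Complex.equivRealProdCLM_apply]

theorem HarmonicOn2.harmonicOnNhd {u : ℝ × ℝ → ℝ} {Ω : Set (ℝ × ℝ)} (hΩ : IsOpen Ω)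
    (h : HarmonicOn2 u Ω) :
    HarmonicOnNhd (u ∘ Complex.equivRealProdCLM) (Complex.equivRealProdCLM ⁻¹' Ω) := by
  intro z hz
  have hc : ∀ p ∈ Ω, ContDiffAt ℝ 2 u p := fun p hp => h.1.contDiffAt (hΩ.mem_nhds hp)
  refine ⟨(hc _ hz).comp z Complex.equivRealProdCLM.contDiff.contDiffAt, ?_⟩
  filter_upwards [(hΩ.preimage Complex.equivRealProdCLM.continuous).mem_nhds hz] with y hy
  rw [laplacian_comp_equivRealProdCLM (hc _ hy), h.2 _ hy]
  rfl

theorem InnerProductSpace.HarmonicAt.sum_mul_const {ι : Type*} {s : Finset ι} {f : ι → ℂ → ℝ}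
    {z : ℂ} (h : ∀ i ∈ s, HarmonicAt (f i) z) (c : ι → ℝ) :
    HarmonicAt (fun x => ∑ i ∈ s, f i x * c i) z := by
  classical
  induction s using Finset.induction_on with
  | empty => simp
  | insert a s ha ih =>
    simp only [Finset.sum_insert ha]
    have h1 : HarmonicAt (fun x => f a x * c a) z := by
      convert (h a (Finset.mem_insert_self a s)).const_smul (c := c a) using 1
      ext x
      simp [mul_comm]
    exact h1.add (ih fun i hi => h i (Finset.mem_insert_of_mem hi))

end Harmonic

/-- A closed curve on a line is not injective. -/
theorem not_injOn_of_apply_eq {γ : ℝ → ℝ × ℝ} (hγ : Continuous γ) (hper : γ 1 = γ 0)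
    {f : ℝ × ℝ →ₗ[ℝ] ℝ} (hf : f ≠ 0) {c : ℝ} (hc : ∀ t, f (γ t) = c) :
    ¬ InjOn γ (Ico 0 1) := by
  intro hinj
  have hfe : ∀ x : ℝ × ℝ, f x = x.1 * f (1, 0) + x.2 * f (0, 1) := fun x => by
    conv_lhs => rw [show x = x.1 • (1, 0) + x.2 • (0, 1) by ext <;> simp]
    rw [map_add, map_smul, map_smul, smul_eq_mul, smul_eq_mul]
  set a := f (1, 0)
  set b := f (0, 1)
  have hab : 0 < a ^ 2 + b ^ 2 := by
    rcases eq_or_ne a 0 with ha | ha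
    · rcases eq_or_ne b 0 with hb | hb
      · exact absurd (LinearMap.ext fun x => by rw [hfe, ha, hb]; simp) hf
      · positivity
    · positivity
  set g : ℝ → ℝ := fun t => a * (γ t).2 - b * (γ t).1 with hg
  have hgc : Continuous g := by fun_prop
  have hg1 : g 1 = g 0 := by simp only [hg, hper]
  have hgi : ∀ s ∈ Ico (0 : ℝ) 1, ∀ t ∈ Ico (0 : ℝ) 1, g s = g t → s = t := by
    intro s hs t ht hst
    refine hinj hs ht ?_
    have h1 := (hc s).trans (hc t).symm
    rw [hfe, hfe] at h1
    simp only [hg] at hst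
    ext
    · have : (a ^ 2 + b ^ 2) * ((γ s).1 - (γ t).1) = 0 := by linear_combination a * h1 - b * hst
      linarith [(mul_eq_zero.1 this).resolve_left hab.ne']
    · have : (a ^ 2 + b ^ 2) * ((γ s).2 - (γ t).2) = 0 := by linear_combination b * h1 + a * hst
      linarith [(mul_eq_zero.1 this).resolve_left hab.ne']
  have hne : g 0 ≠ g (1 / 2) := fun h => by
    have := hgi 0 (by norm_num) (1 / 2) (by norm_num) h
    norm_num at this
  have hm : (g 0 + g (1 / 2)) / 2 ∈ uIcc (g 0) (g (1 / 2)) := by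
    rcases le_total (g 0) (g (1 / 2)) with h | h
    · rw [uIcc_of_le h]; constructor <;> linarith
    · rw [uIcc_of_ge h]; constructor <;> linarith
  obtain ⟨s, hs, hgs⟩ := intermediate_value_uIcc hgc.continuousOn hm
  rw [← hg1, uIcc_comm] at hm
  obtain ⟨t, ht, hgt⟩ := intermediate_value_uIcc hgc.continuousOn hm
  rw [uIcc_of_le (by norm_num)] at hs ht
  have ht1 : t ≠ 1 := by
    rintro rfl
    exact hne (by linarith)
  have hs2 : s ≠ 1 / 2 := by
    rintro rfl
    exact hne (by linarith)
  have := hgi s ⟨hs.1, by linarith [hs.2]⟩ t ⟨by linarith [ht.1], lt_of_le_of_ne ht.2 ht1⟩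
    (by rw [hgs, hgt, hg1])
  exact hs2 (le_antisymm hs.2 (this ▸ ht.1))

theorem interior_convexHull_nonempty_of_injOn {s : Set (ℝ × ℝ)} {γ : ℝ → ℝ × ℝ}
    (hγ : Continuous γ) (hper : γ 1 = γ 0) (hinj : InjOn γ (Ico 0 1))
    (hs : ∀ t, γ t ∈ convexHull ℝ s) : (interior (convexHull ℝ s)).Nonempty := by
  rw [interior_convexHull_nonempty_iff_affineSpan_eq_top]
  by_contra htop
  have hmem : ∀ t, γ t ∈ affineSpan ℝ s := fun t => convexHull_subset_affineSpan s (hs t)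
  have hne : (affineSpan ℝ s).direction < ⊤ := lt_top_iff_ne_top.2 fun h =>
    htop ((AffineSubspace.direction_eq_top_iff_of_nonempty ⟨γ 0, hmem 0⟩).1 h)
  obtain ⟨f, hf, hle⟩ := Submodule.exists_le_ker_of_lt_top _ hne
  refine not_injOn_of_apply_eq hγ hper hf (c := f (γ 0)) (fun t => ?_) hinj
  have := hle (AffineSubspace.vsub_mem_direction (hmem t) (hmem 0))
  rwa [LinearMap.mem_ker, vsub_eq_sub, map_sub, sub_eq_zero] at this

theorem finite_range_of_add_eq {α : Type*} {n : ℕ} (hn : 0 < n) {w : ℕ → α}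
    (hw : ∀ i, w (i + n) = w i) : (range w).Finite :=
  (Set.toFinite (w '' Set.Iio n)).subset <| by
    rintro _ ⟨i, rfl⟩
    exact ⟨i % n, Nat.mod_lt i hn, Function.Periodic.map_mod_nat hw i⟩

theorem exists_eq_add_div {n : ℕ} (hn : 0 < n) {t : ℝ} (ht : 0 ≤ t) :
    ∃ i : ℕ, ∃ s ∈ Icc (0 : ℝ) 1, t = (i + s) / n := by
  have hn' : (0 : ℝ) < n := by exact_mod_cast hn
  have h0 : 0 ≤ t * n := by positivity
  refine ⟨⌊t * n⌋₊, t * n - ⌊t * n⌋₊, ⟨?_, ?_⟩, ?_⟩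
  · linarith [Nat.floor_le h0]
  · linarith [Nat.lt_floor_add_one (t * n)]
  · field_simp
    ring

theorem IsCCWBoundaryParam.bijOn {γ : ℝ → ℝ × ℝ} {V : Set (ℝ × ℝ)} (h : IsCCWBoundaryParam γ V) :
    BijOn γ (Ico 0 1) (frontier V) :=
  h.2.2.2.1 ▸ h.2.2.1.bijOn_image

theorem IsCCWBoundaryParam.mem_frontier {γ : ℝ → ℝ × ℝ} {V : Set (ℝ × ℝ)}
    (h : IsCCWBoundaryParam γ V) (t : ℝ) : γ t ∈ frontier V := by
  obtain ⟨s, hs, hst⟩ := Function.Periodic.exists_mem_Ico₀ h.2.1 one_pos t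
  rw [hst]
  exact h.bijOn.mapsTo hs

/-- Near the midpoint of an edge, the boundary of a polygon lies on a line. -/
theorem IsPolygonalCCWParam.exists_flat {γ : ℝ → ℝ × ℝ} {n : ℕ} {v : ℕ → ℝ × ℝ}
    {V : Set (ℝ × ℝ)} (h : IsPolygonalCCWParam γ n v V) (hn : 2 ≤ n) :
    ∃ p ∈ frontier V, ∃ l : ℝ × ℝ →L[ℝ] ℝ, l ≠ 0 ∧ ∃ c : ℝ,
      ∀ᶠ x in 𝓝 p, x ∈ frontier V → l x = c := by
  have hn' : (2 : ℝ) ≤ n := by exact_mod_cast hn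
  have hn0 : (0 : ℝ) < n := by linarith
  have hinv : (1 : ℝ) / n < 1 := by rw [div_lt_one hn0]; linarith
  have hedge := h.2
  have h0 : γ 0 = v 0 := by simpa using hedge 0 0 (by norm_num)
  have h1 : γ (1 / n) = v 1 := by simpa using hedge 0 1 (by norm_num)
  have hγ1 : γ 1 = γ 0 := by simpa using h.1.2.1 0
  have hmid : (1 / 2 : ℝ) / n ∈ Ioo 0 (1 / (n : ℝ)) :=
    ⟨by positivity, by gcongr; norm_num⟩
  have hv : v 0 ≠ v 1 := fun hv => by
    have := h.1.2.2.1 ⟨le_rfl, one_pos⟩ ⟨by positivity, hinv⟩ (h0.trans (hv.trans h1.symm))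
    exact absurd this (by positivity)
  set d := v 1 - v 0 with hd
  have hd0 : d ≠ 0 := sub_ne_zero.2 hv.symm
  set l : ℝ × ℝ →L[ℝ] ℝ :=
    d.1 • ContinuousLinearMap.snd ℝ ℝ ℝ - d.2 • ContinuousLinearMap.fst ℝ ℝ ℝ with hl
  have hlx : ∀ x, l x = d.1 * x.2 - d.2 * x.1 := fun x => by simp [hl]
  have hl01 : l (v 1) = l (v 0) := by
    rw [hlx, hlx, hd, Prod.fst_sub, Prod.snd_sub]
    ring
  refine ⟨_, h.1.mem_frontier (1 / 2 / n), l, fun hl0 => hd0 ?_, l (v 0), ?_⟩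
  · have e1 := hlx (0, 1)
    have e2 := hlx (1, 0)
    simp [hl0] at e1 e2
    exact Prod.ext e1.symm e2
  · have hcl : IsClosed (γ '' Icc (1 / n) 1) := (isCompact_Icc.image h.1.1).isClosed
    have hp : γ (1 / 2 / n) ∉ γ '' Icc (1 / n) 1 := by
      rintro ⟨t, ht, hpt⟩
      rcases ht.2.lt_or_eq with ht1 | rfl
      · have := h.1.2.2.1 ⟨le_trans (by positivity) ht.1, ht1⟩
          ⟨hmid.1.le, hmid.2.trans hinv⟩ hpt
        linarith [hmid.2, ht.1]
      · have := h.1.2.2.1 ⟨le_rfl, one_pos⟩ ⟨hmid.1.le, hmid.2.trans hinv⟩ (hγ1.symm.trans hpt)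
        linarith [hmid.1]
    filter_upwards [hcl.isOpen_compl.mem_nhds hp] with x hx hxV
    obtain ⟨t, ht, rfl⟩ := h.1.bijOn.surjOn hxV
    have htn : t < 1 / n := by
      by_contra! htn
      exact hx ⟨t, ⟨htn, ht.2.le⟩, rfl⟩
    have := hedge 0 (t * n) ⟨mul_nonneg ht.1 hn0.le, (lt_div_iff₀ hn0).1 htn |>.le⟩
    rw [Nat.cast_zero, zero_add, zero_add, mul_div_cancel_right₀ _ hn0.ne'] at this
    rw [this, map_add, map_smul, map_smul, hl01, smul_eq_mul, smul_eq_mul]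
    ring

namespace IsHarmonicGBC

variable {n : ℕ} {v w : ℕ → ℝ × ℝ} {V W : Set (ℝ × ℝ)} {φ : ℕ → ℝ × ℝ → ℝ}

theorem sum_smul_vertex (hφ : IsHarmonicGBC n v V φ) (hn : 0 < n) (hv : ∀ i, v (i + n) = v i)
    (hw : ∀ i, w (i + n) = w i) (j : ℕ) : ∑ i ∈ Finset.range n, φ i (v j) • w i = w j := by
  obtain ⟨-, -, -, -, -, -, hδ⟩ := hφ
  have hj := Nat.mod_lt j hn
  rw [← Function.Periodic.map_mod_nat hv j, ← Function.Periodic.map_mod_nat hw j,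
    Finset.sum_eq_single_of_mem _ (Finset.mem_range.2 hj)]
  · rw [hδ _ _ hj hj, if_pos rfl, one_smul]
  · intro i hi hij
    rw [hδ _ _ (Finset.mem_range.1 hi) hj, if_neg hij, zero_smul]

theorem sum_smul_param (hφ : IsHarmonicGBC n v V φ) (hn : 0 < n) (hv : ∀ i, v (i + n) = v i)
    (hw : ∀ i, w (i + n) = w i) {γ δ : ℝ → ℝ × ℝ} (hγ : IsPolygonalCCWParam γ n v V)
    (hδ : IsPolygonalCCWParam δ n w W) {t : ℝ} (ht : 0 ≤ t) :
    ∑ i ∈ Finset.range n, φ i (γ t) • w i = δ t := by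
  obtain ⟨j, s, hs, rfl⟩ := exists_eq_add_div hn ht
  rw [hγ.2 j s hs, hδ.2 j s hs]
  simp only [hφ.2.2.2.2.2.1 _ j s hs, add_smul, mul_smul, Finset.sum_add_distrib,
    ← Finset.smul_sum]
  rw [hφ.sum_smul_vertex hn hv hw, hφ.sum_smul_vertex hn hv hw]

theorem isKneserMap (hφ : IsHarmonicGBC n v V φ) (hV : IsSimplePolygonCCW V n v)
    (hW : IsConvexPolygonCCW W n w) {γ : ℝ → ℝ × ℝ} (hγ : IsPolygonalCCWParam γ n v V) :
    IsKneserMap (Complex.equivRealProdCLM ⁻¹' V) (Complex.equivRealProdCLM.symm ∘ γ) W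
      ((fun x => ∑ i ∈ Finset.range n, φ i x • w i) ∘ Complex.equivRealProdCLM) := by
  obtain ⟨hn3, hv, hVc, hVi, -, -⟩ := hV
  obtain ⟨hw, hWh, δ, hδ⟩ := hW
  have hn : 0 < n := by omega
  set e := Complex.equivRealProdCLM
  have he : IsHomeomorph e := e.toHomeomorph.isHomeomorph
  have hfr : frontier (e ⁻¹' V) = e ⁻¹' frontier V := (e.toHomeomorph.preimage_frontier V).symm
  have hin : interior (e ⁻¹' V) = e ⁻¹' interior V := (e.toHomeomorph.preimage_interior V).symm
  have heb : BijOn e (e ⁻¹' frontier V) (frontier V) :=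
    ⟨mapsTo_preimage _ _, e.injective.injOn, fun x hx => ⟨e.symm x, by simpa using hx, by simp⟩⟩
  have hδ0 : δ 1 = δ 0 := by simpa using hδ.1.2.1 0
  have hWc : IsCompact W := hWh ▸ (finite_range_of_add_eq hn hw).isCompact_convexHull ℝ
  have hδW : ∀ t, δ t ∈ W := fun t => hWc.isClosed.frontier_subset (hδ.1.mem_frontier t)
  exact {
    isCompact_source := e.toHomeomorph.isCompact_preimage.2 hVc
    closure_interior_source := by
      rw [hin, ← e.preimage_closure, ← hVi]
    continuous_param := e.symm.continuous.comp hγ.1.1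
    periodic_param := fun t => congrArg e.symm (hγ.1.2.1 t)
    injOn_param := e.symm.injective.injOn.comp hγ.1.2.2.1 (mapsTo_univ _ _)
    image_param := by
      rw [image_comp, hγ.1.2.2.2.1, hfr]
      exact e.symm.toEquiv.image_eq_preimage_symm _
    isCompact_target := hWc
    convex_target := hWh ▸ convex_convexHull ℝ _
    nonempty_interior_target := hWh ▸ interior_convexHull_nonempty_of_injOn hδ.1.1 hδ0
      hδ.1.2.2.1 fun t => hWh ▸ hδW t
    continuousOn := by
      refine ContinuousOn.comp (t := V) ?_ e.continuous.continuousOn fun _ h => h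
      exact continuousOn_finsetSum _ fun i _ => (hφ.1 i).smul continuousOn_const
    mapsTo := by
      intro x hx
      rw [hWh]
      exact (convex_convexHull ℝ (range w)).sum_mem (fun i _ => hφ.2.2.2.2.1 i _ hx)
        (hφ.2.2.1 _ hx) fun i _ => subset_convexHull ℝ _ (mem_range_self i)
    bijOn_frontier := by
      rw [hfr]
      exact (hγ.1.bijOn.of_comp_eqOn (F := fun x => ∑ i ∈ Finset.range n, φ i x • w i) hδ.1.bijOn
        fun t ht => hφ.sum_smul_param hn hv hw hγ hδ ht.1).comp heb
    harmonicOnNhd := by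
      intro l z hz
      rw [hin] at hz
      have := InnerProductSpace.HarmonicAt.sum_mul_const (s := Finset.range n)
        (fun i _ => (hφ.2.1 i).harmonicOnNhd isOpen_interior z hz) fun i => l (w i)
      convert this using 1
      ext x
      simp [e] }

end IsHarmonicGBC

/-- The harmonic GBC map from a simple polygon `V` (vertices counterclockwise)
to a convex polygon `W` (vertices counterclockwise) is a bijection from `V` onto `W`. -/
theorem harmonic_gbc_map_bijective (n : ℕ) (v w : ℕ → ℝ × ℝ) (V W : Set (ℝ × ℝ))
    (φ : ℕ → (ℝ × ℝ) → ℝ) (hV : IsSimplePolygonCCW V n v) (hφ : IsHarmonicGBC n v V φ)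
    (hW : IsConvexPolygonCCW W n w) :
    Set.BijOn (fun x => ∑ i ∈ Finset.range n, φ i x • w i) V W := by
  have hn : 2 ≤ n := le_trans (by norm_num) hV.1
  obtain ⟨γ, hγ⟩ := hV.2.2.2.2.2
  obtain ⟨p, hp, l, hl, c, hc⟩ := hγ.exists_flat hn
  have K := hφ.isKneserMap hV hW hγ
  set e := Complex.equivRealProdCLM
  have hfr : frontier (e ⁻¹' V) = e ⁻¹' frontier V := (e.toHomeomorph.preimage_frontier V).symm
  have hc' : ∀ᶠ x in 𝓝 (e.symm p), e x ∈ frontier V → l (e x) = c :=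
    e.continuous.continuousAt.eventually (by rwa [e.apply_symm_apply])
  obtain ⟨r, hr, hball⟩ := Metric.eventually_nhds_iff_ball.1 hc'
  have hbij := K.bijOn (p := e.symm p) (by simpa [hfr] using hp) hr
    (l := l.comp (e : ℂ →L[ℝ] ℝ × ℝ)) (c := c) ?_ fun x hx hxV => hball x hx (by rwa [hfr] at hxV)
  · have heb : BijOn e (e ⁻¹' V) V :=
      ⟨mapsTo_preimage _ _, e.injective.injOn, fun x hx => ⟨e.symm x, by simpa using hx, by simp⟩⟩
    exact heb.of_comp_eqOn hbij fun _ _ => rfl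
  · intro h
    refine hl (ContinuousLinearMap.ext fun x => ?_)
    simpa using DFunLike.congr_fun h (e.symm x)
end

section
/- Let V and W be compact subsets of ℝ² that are closures of bounded simply connected open sets, with W convex. Let F = (u, v) : V → ℝ² where u and v are continuous on V and harmonic on the interior of V, and suppose the restriction of F to ∂V is a homeomorphism from ∂V onto ∂W. Then F maps V onto W, i.e., F(V) = W. -/
open Set Filter Topology

/-- `V` is the closure of a bounded, nonempty, simply connected open subset of `ℝ²`. -/
def IsClosureOfSCRegion (V : Set (ℝ × ℝ)) : Prop :=
  ∃ Ω : Set (ℝ × ℝ), IsOpen Ω ∧ Bornology.IsBounded Ω ∧ Ω.Nonempty ∧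
    SimplyConnectedSpace Ω ∧ V = closure Ω

/-- A continuous self-map of the plane fixing a circle pointwise takes the value at the centre. -/
theorem mem_range_of_eqOn_circle {f : ℂ → ℂ} (hf : Continuous f) {p : ℂ} {R : ℝ}
    (hfix : ∀ θ, f (circleMap p R θ) = circleMap p R θ) : p ∈ range f := by
  by_contra hp
  have hne : ∀ z, f z - p ≠ 0 := fun z hz => hp ⟨z, sub_eq_zero.1 hz⟩
  have hsc : IsSimplyConnected (univ : Set ℂ) := by
    have : ContractibleSpace (univ : Set ℂ) := convex_univ.contractibleSpace univ_nonempty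
    exact SimplyConnectedSpace.ofContractible _
  obtain ⟨g, hgc, hg⟩ := Complex.exists_continuousOn_eqOn_exp_comp (X := ℂ) (U := univ)
    hsc isOpen_univ
    (g := fun z => f z - p) (by fun_prop) (by rintro ⟨z, -, hz⟩; exact hne z hz)
  have hgc : Continuous g := continuousOn_univ.1 hgc
  have hexp : ∀ z, Complex.exp (g z) = f z - p := fun z => hg (mem_univ z)
  have hcirc : ∀ θ : ℝ, Complex.exp (g (circleMap p R θ)) = R * Complex.exp (θ * Complex.I) := by
    intro θ
    rw [hexp, hfix, circleMap]
    ring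
  have key : (fun θ : ℝ => g (circleMap p R θ)) =
      fun θ : ℝ => θ * Complex.I + g (circleMap p R 0) := by
    refine Complex.isCoveringMap_exp.eq_of_comp_eq (by fun_prop) (by fun_prop) ?_ 0 (by simp)
    funext θ
    apply Subtype.ext
    change Complex.exp _ = Complex.exp _
    rw [Complex.exp_add, hcirc, hcirc]
    simp [mul_comm]
  have h2 := congrFun key (2 * Real.pi)
  have hper : circleMap p R (2 * Real.pi) = circleMap p R 0 := by
    simpa using periodic_circleMap p R 0
  simp [hper, Real.pi_ne_zero] at h2

/-- A continuous self-map of `ℝ²` that is the identity off a bounded set is surjective. -/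
theorem surjective_of_eqOn_compl_isBounded {f : ℝ × ℝ → ℝ × ℝ} (hf : Continuous f)
    {K : Set (ℝ × ℝ)} (hK : Bornology.IsBounded K) (hfix : EqOn f id Kᶜ) :
    Function.Surjective f := by
  intro p
  let e := Complex.equivRealProdCLM
  have hb : Bornology.IsBounded (e.symm '' K) :=
    e.symm.lipschitz.isBounded_image hK
  obtain ⟨R, hR⟩ := hb.subset_ball (e.symm p)
  have hR' : e.symm '' K ⊆ Metric.ball (e.symm p) (|R| + 1) :=
    hR.trans (Metric.ball_subset_ball (by linarith [le_abs_self R]))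
  have hpos : (0 : ℝ) < |R| + 1 := by positivity
  obtain ⟨z, hz⟩ := mem_range_of_eqOn_circle (f := fun z => e.symm (f (e z)))
    (e.symm.continuous.comp (hf.comp e.continuous)) (p := e.symm p) (R := |R| + 1) (by
      intro θ
      have : e (circleMap (e.symm p) (|R| + 1) θ) ∈ Kᶜ := by
        intro hmem
        have h1 := hR' (mem_image_of_mem e.symm hmem)
        rw [e.symm_apply_apply] at h1
        have h2 := circleMap_mem_sphere (e.symm p) hpos.le θ
        rw [Metric.mem_sphere] at h2
        rw [Metric.mem_ball, h2] at h1
        exact lt_irrefl _ h1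
      simp [hfix this])
  exact ⟨e z, e.symm.injective hz⟩

/-- A bounded closed subset of `ℝ²` with an interior point does not retract onto its frontier. -/
theorem not_retract_onto_frontier {K : Set (ℝ × ℝ)} (hK : Bornology.IsBounded K)
    (hKc : IsClosed K) (hint : (interior K).Nonempty) {r : ℝ × ℝ → ℝ × ℝ}
    (hr : ContinuousOn r K) (hmaps : MapsTo r K (frontier K)) (hfix : EqOn r id (frontier K)) :
    False := by
  classical
  obtain ⟨p, hp⟩ := hint
  have hcont : Continuous (K.piecewise r id) :=
    continuous_piecewise hfix (by rwa [hKc.closure_eq]) continuousOn_id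
  obtain ⟨q, hq⟩ := surjective_of_eqOn_compl_isBounded hcont hK
    (piecewise_eqOn_compl K r id) p
  by_cases hqK : q ∈ K
  · rw [piecewise_eq_of_mem _ _ _ hqK] at hq
    exact (hq ▸ hmaps hqK).2 hp
  · rw [piecewise_eq_of_notMem _ _ _ hqK] at hq
    obtain rfl : q = p := hq
    exact hqK (interior_subset hp)

/-- Radial projection of a bounded convex set from an interior point onto the frontier. -/
theorem exists_continuousOn_retraction_frontier {E : Type*} [NormedAddCommGroup E]
    [NormedSpace ℝ E] {W : Set E} (hW : Convex ℝ W) (hb : Bornology.IsBounded W) {w : E}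
    (hw : w ∈ interior W) :
    ∃ ρ : E → E, ContinuousOn ρ {w}ᶜ ∧ MapsTo ρ {w}ᶜ (frontier W) ∧ EqOn ρ id (frontier W) := by
  set S : Set E := (fun x => w + x) ⁻¹' W with hS
  have hSc : Convex ℝ S := hW.translate_preimage_right w
  have hS0 : S ∈ 𝓝 (0 : E) := by
    have : Tendsto (fun x : E => w + x) (𝓝 0) (𝓝 w) := by
      simpa using (continuous_const_add w).tendsto 0
    exact this (mem_interior_iff_mem_nhds.1 hw)
  have hSb : Bornology.IsVonNBounded ℝ S := by
    rw [NormedSpace.isVonNBounded_iff]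
    exact (isometry_add_left w).antilipschitz.isBounded_preimage hb
  have hfr : ∀ x, x ∈ frontier S ↔ w + x ∈ frontier W := by
    intro x
    have := (Homeomorph.addLeft w).preimage_frontier W
    exact (Set.ext_iff.1 this x).symm
  have hgc := continuous_gauge hSc hS0
  have hgp : ∀ x, x ≠ w → 0 < gauge S (x - w) := fun x hx =>
    (gauge_pos (absorbent_nhds_zero hS0) hSb).2 (sub_ne_zero.2 hx)
  refine ⟨fun x => w + (gauge S (x - w))⁻¹ • (x - w), ?_, ?_, ?_⟩
  · refine continuousOn_const.add (ContinuousOn.smul (ContinuousOn.inv₀ ?_ ?_) ?_)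
    · exact (hgc.comp (continuous_sub_right w)).continuousOn
    · exact fun x hx => (hgp x hx).ne'
    · fun_prop
  · intro x hx
    rw [← hfr, ← gauge_eq_one_iff_mem_frontier hSc hS0,
      gauge_smul_of_nonneg (inv_nonneg.2 (hgp x hx).le), smul_eq_mul,
      inv_mul_cancel₀ (hgp x hx).ne']
  · intro x hx
    have h1 : gauge S (x - w) = 1 := by
      rw [gauge_eq_one_iff_mem_frontier hSc hS0, hfr]
      simpa using hx
    simp [h1]

/-- A function with a local maximum at `a` has nonpositive second derivative there. -/
theorem IsLocalMax.second_deriv_nonpos {f f' : ℝ → ℝ} {f'' a : ℝ} (hmax : IsLocalMax f a)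
    (hf : ∀ᶠ t in 𝓝 a, HasDerivAt f (f' t) t) (hf' : HasDerivAt f' f'' a) : f'' ≤ 0 := by
  by_contra! hpos
  have hd : deriv f =ᶠ[𝓝 a] f' := hf.mono fun t ht => ht.deriv
  have h2 : deriv (deriv f) a = f'' := by rw [hd.deriv_eq, hf'.deriv]
  have hmin : IsLocalMin f a := isLocalMin_of_deriv_deriv_pos (h2 ▸ hpos) hmax.deriv_eq_zero
    hf.self_of_nhds.continuousAt
  have hc : f =ᶠ[𝓝 a] fun _ => f a := by
    filter_upwards [hmax, hmin] with t h1 h2 using le_antisymm h1 h2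
  have : deriv (deriv f) a = 0 := by
    rw [hc.deriv.deriv_eq]
    simp
  linarith

/-- Weak maximum principle for harmonic functions on a compact subset of the plane. -/
theorem HarmonicOn2.le_of_le_frontier {V : Set (ℝ × ℝ)} (hV : IsCompact V) {h : ℝ × ℝ → ℝ}
    (hc : ContinuousOn h V) (hh : HarmonicOn2 h (interior V)) {c : ℝ}
    (hfr : ∀ p ∈ frontier V, h p ≤ c) {p : ℝ × ℝ} (hp : p ∈ V) : h p ≤ c := by
  by_contra! hlt
  obtain ⟨M, hM⟩ := (hV.image (f := fun q : ℝ × ℝ => q.1 ^ 2) (by fun_prop)).bddAbove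
  have hM : ∀ q ∈ V, q.1 ^ 2 ≤ M := fun q hq => hM (mem_image_of_mem _ hq)
  have hM0 : 0 ≤ M := (sq_nonneg _).trans (hM p hp)
  obtain ⟨ε, hε, hεM⟩ : ∃ ε > 0, ε * M < h p - c := by
    refine ⟨(h p - c) / (M + 1), by have := sub_pos.2 hlt; positivity, ?_⟩
    rw [div_mul_eq_mul_div, div_lt_iff₀ (by linarith)]
    nlinarith
  obtain ⟨q, hqV, hq⟩ := hV.exists_isMaxOn ⟨p, hp⟩
    (f := fun q : ℝ × ℝ => h q + ε * q.1 ^ 2) (by fun_prop)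
  have hqi : q ∈ interior V := by
    by_contra hqi
    have h1 := hfr q ⟨subset_closure hqV, hqi⟩
    have h2 : h p + ε * p.1 ^ 2 ≤ h q + ε * q.1 ^ 2 := hq hp
    have h3 := mul_le_mul_of_nonneg_left (hM q hqV) hε.le
    have h4 : 0 ≤ ε * p.1 ^ 2 := by positivity
    linarith
  have hlocmax : IsLocalMax (fun q : ℝ × ℝ => h q + ε * q.1 ^ 2) q :=
    hq.isLocalMax (mem_interior_iff_mem_nhds.1 hqi)
  have hdir : ∀ e : ℝ × ℝ,
      fderiv ℝ (fun x => fderiv ℝ h x e) q e + 2 * ε * e.1 ^ 2 ≤ 0 := by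
    intro e
    have hline : ∀ t : ℝ, HasDerivAt (fun t : ℝ => q + t • e) e t := fun t => by
      simpa using ((hasDerivAt_id t).smul_const e).const_add q
    have htend : Tendsto (fun t : ℝ => q + t • e) (𝓝 0) (𝓝 q) := by
      simpa using (hline 0).continuousAt.tendsto
    have hsq : ∀ t : ℝ, HasDerivAt (fun t : ℝ => ε * (q.1 + t * e.1) ^ 2)
        (2 * ε * e.1 * (q.1 + t * e.1)) t := fun t => by
      have := ((((hasDerivAt_id t).mul_const e.1).const_add q.1).pow 2).const_mul ε
      refine this.congr_deriv ?_
      simp only [id]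
      push_cast
      ring
    have hmax : IsLocalMax (fun t : ℝ => h (q + t • e) + ε * (q.1 + t * e.1) ^ 2) 0 := by
      have := htend.eventually hlocmax
      filter_upwards [this] with t ht
      simpa using ht
    refine hmax.second_deriv_nonpos
      (f' := fun t => fderiv ℝ h (q + t • e) e + 2 * ε * e.1 * (q.1 + t * e.1)) ?_ ?_
    · filter_upwards [htend (isOpen_interior.mem_nhds hqi)] with t ht
      have hd : DifferentiableAt ℝ h (q + t • e) :=
        (hh.1.contDiffAt (isOpen_interior.mem_nhds ht)).differentiableAt (by norm_num)
      exact (hd.hasFDerivAt.comp_hasDerivAt t (hline t)).add (hsq t)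
    · have hd : DifferentiableAt ℝ (fun x => fderiv ℝ h x e) q := by
        have : ContDiffAt ℝ 1 (fderiv ℝ h) q :=
          (hh.1.contDiffAt (isOpen_interior.mem_nhds hqi)).fderiv_right (by norm_num)
        exact (this.differentiableAt (by norm_num)).clm_apply (differentiableAt_const e)
      have h0 : HasFDerivAt (fun x => fderiv ℝ h x e) (fderiv ℝ (fun x => fderiv ℝ h x e) q)
          (q + (0 : ℝ) • e) := by simpa using hd.hasFDerivAt
      have h1 := h0.comp_hasDerivAt (0 : ℝ) (hline 0)
      have h2 : HasDerivAt (fun t : ℝ => 2 * ε * e.1 * (q.1 + t * e.1)) (2 * ε * e.1 ^ 2) 0 := by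
        have := (((hasDerivAt_id (0 : ℝ)).mul_const e.1).const_add q.1).const_mul (2 * ε * e.1)
        exact this.congr_deriv (by ring)
      exact h1.add h2
  have h1 := hdir (1, 0)
  have h2 := hdir (0, 1)
  have h3 := hh.2 q hqi
  rw [lap2] at h3
  norm_num at h1 h2
  linarith

/-- Real linear combinations of harmonic functions on an open set are harmonic. -/
theorem HarmonicOn2.linear_combination {Ω : Set (ℝ × ℝ)} (hΩ : IsOpen Ω) {u v : ℝ × ℝ → ℝ}
    (hu : HarmonicOn2 u Ω) (hv : HarmonicOn2 v Ω) (a b : ℝ) :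
    HarmonicOn2 (fun p => a * u p + b * v p) Ω := by
  refine ⟨(contDiffOn_const.mul hu.1).add (contDiffOn_const.mul hv.1), fun p hp => ?_⟩
  have hdiff : ∀ {w : ℝ × ℝ → ℝ}, HarmonicOn2 w Ω → ∀ q ∈ Ω, DifferentiableAt ℝ w q :=
    fun hw q hq => (hw.1.contDiffAt (hΩ.mem_nhds hq)).differentiableAt (by norm_num)
  have hdiff2 : ∀ {w : ℝ × ℝ → ℝ}, HarmonicOn2 w Ω → ∀ e : ℝ × ℝ,
      DifferentiableAt ℝ (fun q => fderiv ℝ w q e) p := fun {w} hw e => by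
    have : ContDiffAt ℝ 1 (fderiv ℝ w) p :=
      (hw.1.contDiffAt (hΩ.mem_nhds hp)).fderiv_right (by norm_num)
    exact (this.differentiableAt (by norm_num)).clm_apply (differentiableAt_const e)
  have hsecond : ∀ e : ℝ × ℝ,
      fderiv ℝ (fun q => fderiv ℝ (fun x => a * u x + b * v x) q e) p e =
        a * fderiv ℝ (fun q => fderiv ℝ u q e) p e +
          b * fderiv ℝ (fun q => fderiv ℝ v q e) p e := by
    intro e
    have hfirst : (fun q => fderiv ℝ (fun x => a * u x + b * v x) q e) =ᶠ[𝓝 p]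
        fun q => a * fderiv ℝ u q e + b * fderiv ℝ v q e := by
      filter_upwards [hΩ.mem_nhds hp] with q hq
      have : HasFDerivAt (fun x => a * u x + b * v x) (a • fderiv ℝ u q + b • fderiv ℝ v q) q :=
        ((hdiff hu q hq).hasFDerivAt.const_mul a).add
        ((hdiff hv q hq).hasFDerivAt.const_mul b)
      rw [this.fderiv]
      simp
    have : HasFDerivAt (fun q => a * fderiv ℝ u q e + b * fderiv ℝ v q e)
        (a • fderiv ℝ (fun q => fderiv ℝ u q e) p + b • fderiv ℝ (fun q => fderiv ℝ v q e) p) p :=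
      ((hdiff2 hu e).hasFDerivAt.const_mul a).add ((hdiff2 hv e).hasFDerivAt.const_mul b)
    rw [hfirst.fderiv_eq, this.fderiv]
    simp
  have h1 := hu.2 p hp
  have h2 := hv.2 p hp
  rw [lap2] at h1 h2 ⊢
  rw [hsecond, hsecond]
  linear_combination a * h1 + b * h2

/-- A planar harmonic map sends a compact set into any closed convex set containing the image of
its frontier. -/
theorem HarmonicOn2.mapsTo_of_mapsTo_frontier {V W : Set (ℝ × ℝ)} (hV : IsCompact V)
    (hWc : IsClosed W) (hW : Convex ℝ W) {u v : ℝ × ℝ → ℝ}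
    (hu : ContinuousOn u V) (hv : ContinuousOn v V)
    (huh : HarmonicOn2 u (interior V)) (hvh : HarmonicOn2 v (interior V))
    (hfr : MapsTo (fun p => (u p, v p)) (frontier V) W) :
    MapsTo (fun p => (u p, v p)) V W := by
  intro p hp
  by_contra hpW
  obtain ⟨l, c, hlW, hlp⟩ := geometric_hahn_banach_closed_point hW hWc hpW
  have hl : ∀ x y : ℝ, l (x, y) = l (1, 0) * x + l (0, 1) * y := by
    intro x y
    have : ((x, y) : ℝ × ℝ) = x • (1, 0) + y • (0, 1) := by simp
    rw [this, map_add, map_smul, map_smul, smul_eq_mul, smul_eq_mul]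
    ring
  have := HarmonicOn2.le_of_le_frontier hV (c := c) (by fun_prop)
    (huh.linear_combination isOpen_interior hvh (l (1, 0)) (l (0, 1)))
    (fun q hq => by
      rw [← hl]
      exact (hlW _ (hfr hq)).le) hp
  rw [← hl] at this
  exact absurd hlp this.not_gt

/-- An injective continuous map on a compact set has a continuous inverse on its image. -/
theorem IsCompact.continuousOn_invFunOn_image {X Y : Type*} [TopologicalSpace X] [Nonempty X]
    [TopologicalSpace Y] [T2Space Y] {K : Set X} (hK : IsCompact K) {f : X → Y}
    (hf : ContinuousOn f K) (hinj : InjOn f K) :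
    ContinuousOn (Function.invFunOn f K) (f '' K) := by
  rw [continuousOn_iff_isClosed]
  intro t ht
  refine ⟨f '' (K ∩ t), ((hK.inter_right ht).image_of_continuousOn
    (hf.mono inter_subset_left)).isClosed, ?_⟩
  ext y
  constructor
  · rintro ⟨hy, x, hx, rfl⟩
    rw [mem_preimage, hinj.leftInvOn_invFunOn hx] at hy
    exact ⟨mem_image_of_mem f ⟨hx, hy⟩, x, hx, rfl⟩
  · rintro ⟨⟨x, ⟨hx, hxt⟩, rfl⟩, hy⟩
    refine ⟨?_, hy⟩
    rwa [mem_preimage, hinj.leftInvOn_invFunOn hx]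

/-- A map `F = (u, v)` with `u, v` continuous on `V` and harmonic on its
interior, whose restriction to `∂V` is a homeomorphism onto `∂W` with `W` convex,
maps `V` onto `W`. -/
theorem harmonic_map_surjective (V W : Set (ℝ × ℝ))
    (hV : IsClosureOfSCRegion V) (hW : IsClosureOfSCRegion W) (hWconv : Convex ℝ W)
    (u v : ℝ × ℝ → ℝ)
    (hu : ContinuousOn u V) (hv : ContinuousOn v V)
    (huh : HarmonicOn2 u (interior V)) (hvh : HarmonicOn2 v (interior V))
    (hinj : Set.InjOn (fun p => (u p, v p)) (frontier V))
    (him : (fun p => (u p, v p)) '' frontier V = frontier W) :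
    (fun p => (u p, v p)) '' V = W := by
  obtain ⟨A, hAo, hAb, hAne, -, rfl⟩ := hV
  obtain ⟨B, hBo, hBb, hBne, -, rfl⟩ := hW
  set F : ℝ × ℝ → ℝ × ℝ := fun p => (u p, v p) with hF
  have hVc : IsCompact (closure A) := hAb.isCompact_closure
  have hFc : ContinuousOn F (closure A) := hu.prodMk hv
  have hfrV : frontier (closure A) ⊆ closure A := isClosed_closure.frontier_subset
  have hfrW : frontier (closure B) ⊆ closure B := isClosed_closure.frontier_subset
  have hVint : (interior (closure A)).Nonempty :=
    hAne.mono (interior_maximal subset_closure hAo)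
  refine Subset.antisymm (mapsTo_iff_image_subset.1 ?_) ?_
  · refine HarmonicOn2.mapsTo_of_mapsTo_frontier hVc isClosed_closure hWconv hu hv huh hvh ?_
    exact fun p hp => hfrW (him ▸ mem_image_of_mem F hp)
  · refine closure_minimal (fun w hw => ?_) (hVc.image_of_continuousOn hFc).isClosed
    by_contra hwF
    obtain ⟨ρ, hρc, hρm, hρ⟩ := exists_continuousOn_retraction_frontier hWconv hBb.closure
      (interior_maximal subset_closure hBo hw)
    have hmaps : MapsTo F (closure A) {w}ᶜ :=
      fun p hp hpw => hwF ⟨p, hp, hpw⟩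
    have hfrc : IsCompact (frontier (closure A)) := hVc.of_isClosed_subset isClosed_frontier hfrV
    have hGc := hfrc.continuousOn_invFunOn_image (hFc.mono hfrV) hinj
    rw [him] at hGc
    refine not_retract_onto_frontier hAb.closure isClosed_closure hVint
      (r := Function.invFunOn F (frontier (closure A)) ∘ ρ ∘ F)
      (hGc.comp (hρc.comp hFc hmaps) (hρm.comp hmaps)) ?_ ?_
    · intro p hp
      have : ρ (F p) ∈ F '' frontier (closure A) := him ▸ hρm (hmaps hp)
      exact Function.invFunOn_mem this
    · intro p hp
      have : F p ∈ frontier (closure B) := him ▸ mem_image_of_mem F hp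
      simp only [Function.comp_apply, hρ this, id]
      exact hinj.leftInvOn_invFunOn hp
end

section
/- Let V ⊆ ℝ² be the closure of a bounded simply connected open set and let W ⊆ ℝ² be a compact set whose boundary ∂W is a Jordan curve. Let F : V → ℝ² be continuous with F(V) ⊆ W, and suppose the restriction of F to ∂V is a homeomorphism from ∂V onto ∂W. Then W ⊆ F(V), i.e., F maps V onto W. -/
open Set Filter Topology

/-- `Γ ⊆ ℝ²` is a Jordan curve: the image of a continuous injective map of the circle,
realized as a 1-periodic continuous loop injective on a period. -/
def IsJordanCurve (Γ : Set (ℝ × ℝ)) : Prop :=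
  ∃ γ : ℝ → ℝ × ℝ, Continuous γ ∧ (∀ t, γ (t + 1) = γ t) ∧
    InjOn γ (Ico (0 : ℝ) 1) ∧ γ '' Ico (0 : ℝ) 1 = Γ

/-- A nonvanishing continuous function on a simply connected, locally path connected space
has a continuous logarithm. -/
theorem exists_continuous_log {A : Type*} [TopologicalSpace A] [SimplyConnectedSpace A]
    [LocallyPathConnectedSpace A] (f : C(A, ℂ)) (hf : ∀ a, f a ≠ 0) :
    ∃ L : C(A, ℂ), ∀ a, Complex.exp (L a) = f a := by
  obtain ⟨a₀⟩ : Nonempty A := inferInstance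
  obtain ⟨L, ⟨-, hL⟩, -⟩ := Complex.isCoveringMap_exp.existsUnique_continuousMap_lifts
    (⟨fun a => ⟨f a, hf a⟩, by fun_prop⟩ : C(A, {z : ℂ // z ≠ 0})) a₀ (Complex.log (f a₀))
    (Subtype.ext (Complex.exp_log (hf a₀)))
  exact ⟨L, fun a => congrArg Subtype.val (congrFun hL a)⟩

theorem eq_of_exp_comp_eq_one {A : Type*} [TopologicalSpace A] [PreconnectedSpace A]
    {φ : A → ℂ} (hφ : Continuous φ) (h : ∀ a, Complex.exp (φ a) = 1) (a b : A) :
    φ a = φ b := by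
  have := Complex.isCoveringMap_exp.eq_of_comp_eq hφ (continuous_const (y := φ b))
    (funext fun x => Subtype.ext ((h x).trans (h b).symm)) b rfl
  exact congrFun this a

/-- On the boundary of a compact set `X`, a nonzero power of `z - b` with `b` interior to `X`
does not agree up to a factor `exp g` with a function that extends to `X` without zeros. -/
theorem not_forall_frontier_eq_zpow_mul_exp {X : Set ℂ} (hX : IsCompact X) {b : ℂ}
    (hb : b ∈ interior X) {f : ℂ → ℂ} (hf : ContinuousOn f X) (hf0 : ∀ z ∈ X, f z ≠ 0)
    {m : ℤ} (hm : m ≠ 0) (g : C(frontier X, ℂ)) :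
    ¬ ∀ z : frontier X, f z = ((z : ℂ) - b) ^ m * Complex.exp (g z) := by
  intro h
  classical
  obtain ⟨G, hG⟩ := ContinuousMap.exists_restrict_eq isClosed_frontier g
  have hG' (z : frontier X) : G z = g z := congrArg (fun k => k z) hG
  set H : ℂ → ℂ := X.piecewise (fun z => f z * Complex.exp (-G z)) (fun z => (z - b) ^ m)
  have hH : Continuous H := by
    apply continuous_piecewise
    · intro a ha
      rw [h ⟨a, ha⟩, ← hG' ⟨a, ha⟩, mul_assoc, ← Complex.exp_add]
      simp
    · rw [hX.isClosed.closure_eq]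
      fun_prop
    · intro z hz
      refine ContinuousAt.continuousWithinAt ?_
      refine ContinuousAt.zpow₀ (by fun_prop) _ (Or.inl ?_)
      rw [closure_compl] at hz
      exact sub_ne_zero.2 fun e => hz (e ▸ hb)
  have hH0 (z : ℂ) : H z ≠ 0 := by
    by_cases hz : z ∈ X
    · simp only [H, piecewise_eq_of_mem _ _ _ hz]
      exact mul_ne_zero (hf0 z hz) (Complex.exp_ne_zero _)
    · simp only [H, piecewise_eq_of_notMem _ _ _ hz]
      exact zpow_ne_zero _ (sub_ne_zero.2 fun e => hz (e ▸ interior_subset hb))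
  obtain ⟨L, hL⟩ := exists_continuous_log ⟨H, hH⟩ hH0
  obtain ⟨R, hR0, hR⟩ := hX.isBounded.subset_ball_lt 0 b
  have hR0' : (R : ℂ) ≠ 0 := by exact_mod_cast hR0.ne'
  let z : ℝ → ℂ := circleMap b R
  have hz (t : ℝ) : H (z t) = Complex.exp (m * (Complex.log R + t * Complex.I)) := by
    have hzX : z t ∉ X := fun hmem => by
      have := hR hmem
      simp [z, Metric.mem_ball, dist_eq_norm, circleMap, abs_of_pos hR0] at this
    simp only [H, piecewise_eq_of_notMem _ _ _ hzX]
    rw [Complex.exp_int_mul, Complex.exp_add, Complex.exp_log hR0']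
    simp [z, circleMap]
  have key := eq_of_exp_comp_eq_one
    (φ := fun t : ℝ => L (z t) - m * (Complex.log R + t * Complex.I))
    (by fun_prop) (fun t => by
      rw [Complex.exp_sub, hL]
      simp only [ContinuousMap.coe_mk, hz]
      exact div_self (Complex.exp_ne_zero _)) (2 * Real.pi) 0
  have hz0 : z (2 * Real.pi) = z 0 := by simp [z, circleMap]
  simp [hz0, hm, Real.pi_ne_zero] at key

/-- On a closed curve, two nonvanishing functions without logarithms have nonzero powers that
agree up to an exponential. -/
theorem exists_zpow_eq_zpow_mul_exp {K : Type*} [TopologicalSpace K] [T2Space K]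
    {σ : ℝ → K} (hσ : Continuous σ) (hσ1 : σ 1 = σ 0) (hinj : InjOn σ (Ico 0 1))
    (hsurj : ∀ x, ∃ t ∈ Ico (0 : ℝ) 1, σ t = x) (f₁ f₂ : C(K, ℂ))
    (h₁ : ∀ x, f₁ x ≠ 0) (h₂ : ∀ x, f₂ x ≠ 0)
    (hl₁ : ¬ ∃ g : C(K, ℂ), ∀ x, f₁ x = Complex.exp (g x))
    (hl₂ : ¬ ∃ g : C(K, ℂ), ∀ x, f₂ x = Complex.exp (g x)) :
    ∃ n m : ℤ, m ≠ 0 ∧ ∃ g : C(K, ℂ), ∀ x, f₁ x ^ n = f₂ x ^ m * Complex.exp (g x) := by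
  have descend (G : C(ℝ, ℂ)) (hG : G 1 = G 0) : ∃ g : C(K, ℂ), ∀ t ∈ Ico (0 : ℝ) 1,
      g (σ t) = G t := by
    let τ : C(Icc (0 : ℝ) 1, K) := ⟨fun t => σ t, by fun_prop⟩
    have hτ : IsQuotientMap τ := IsQuotientMap.of_surjective_continuous (fun x => by
      obtain ⟨t, ht, rfl⟩ := hsurj x
      exact ⟨⟨t, Ico_subset_Icc_self ht⟩, rfl⟩) τ.continuous
    have red (t : Icc (0 : ℝ) 1) : ∃ s ∈ Ico (0 : ℝ) 1, σ s = σ t ∧ G s = G t := by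
      rcases eq_or_lt_of_le t.2.2 with h | h
      · exact ⟨0, by simp, by rw [h, hσ1], by rw [h, hG]⟩
      · exact ⟨t, ⟨t.2.1, h⟩, rfl, rfl⟩
    let G' : C(Icc (0 : ℝ) 1, ℂ) := ⟨fun t => G t, by fun_prop⟩
    have hfac : Function.FactorsThrough G' τ := by
      intro a c hac
      obtain ⟨s, hs, hs1, hs2⟩ := red a
      obtain ⟨u, hu, hu1, hu2⟩ := red c
      have : s = u := hinj hs hu (hs1.trans (Eq.trans hac hu1.symm))
      change G a = G c
      rw [← hs2, ← hu2, this]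
    exact ⟨hτ.lift G' hfac, fun t ht =>
      DFunLike.congr_fun (hτ.lift_comp G' hfac) ⟨t, Ico_subset_Icc_self ht⟩⟩
  have degree (f : C(K, ℂ)) (hf : ∀ x, f x ≠ 0)
      (hl : ¬ ∃ g : C(K, ℂ), ∀ x, f x = Complex.exp (g x)) :
      ∃ G : C(ℝ, ℂ), (∀ t, Complex.exp (G t) = f (σ t)) ∧ ∃ n : ℤ, n ≠ 0 ∧
        G 1 = G 0 + n * (2 * Real.pi * Complex.I) := by
    obtain ⟨G, hG⟩ := exists_continuous_log (f.comp ⟨σ, hσ⟩) fun t => hf _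
    obtain ⟨n, hn⟩ := Complex.exp_eq_exp_iff_exists_int.1
      ((hG 1).trans ((congrArg f hσ1).trans (hG 0).symm))
    refine ⟨G, hG, n, fun h0 => hl ?_, hn⟩
    obtain ⟨g, hg⟩ := descend G (by simpa [h0] using hn)
    refine ⟨g, fun x => ?_⟩
    obtain ⟨t, ht, rfl⟩ := hsurj x
    rw [hg t ht]
    exact (hG t).symm
  obtain ⟨G₁, hG₁, n₁, hn₁, e₁⟩ := degree f₁ h₁ hl₁
  obtain ⟨G₂, hG₂, n₂, hn₂, e₂⟩ := degree f₂ h₂ hl₂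
  obtain ⟨g, hg⟩ := descend ((n₂ : ℂ) • G₁ - (n₁ : ℂ) • G₂) (by
    simp only [ContinuousMap.sub_apply, ContinuousMap.smul_apply, e₁, e₂, smul_eq_mul]
    ring)
  refine ⟨n₂, n₁, hn₁, g, fun x => ?_⟩
  obtain ⟨t, ht, rfl⟩ := hsurj x
  rw [hg t ht, ← hG₁, ← hG₂, ← Complex.exp_int_mul, ← Complex.exp_int_mul, ← Complex.exp_add]
  simp

/-- A continuous map between compact plane sets which restricts to a homeomorphism of their
boundaries, these being Jordan curves, is onto if its source has an interior point. -/
theorem subset_image_of_injOn_frontier {V W : Set ℂ} (hV : IsCompact V)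
    (hVi : (interior V).Nonempty) (hW : IsCompact W) {γ : ℝ → ℂ} (hγ : Continuous γ)
    (hγ1 : γ 1 = γ 0) (hγi : InjOn γ (Ico 0 1)) (hγW : γ '' Ico 0 1 = frontier W)
    (hγm : ∀ t, γ t ∈ frontier W) {F : ℂ → ℂ} (hF : ContinuousOn F V)
    (hinj : InjOn F (frontier V)) (him : F '' frontier V = frontier W) : W ⊆ F '' V := by
  intro w hw
  by_contra hwF
  have hVf : frontier V ⊆ V := hV.isClosed.frontier_subset
  have hwi : w ∈ interior W := by
    by_contra hwi
    have : w ∈ frontier W := ⟨subset_closure hw, hwi⟩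
    rw [← him] at this
    exact hwF (image_mono hVf this)
  obtain ⟨b, hb⟩ := hVi
  have : CompactSpace (frontier V) :=
    isCompact_iff_compactSpace.1 (hV.of_isClosed_subset isClosed_frontier hVf)
  have hbij : BijOn F (frontier V) (frontier W) := ⟨him ▸ mapsTo_image _ _, hinj, him.ge⟩
  have hcont : Continuous hbij.equiv :=
    (continuousOn_iff_continuous_domRestrict.1 (hF.mono hVf)).subtype_mk _
  let h : frontier V ≃ₜ frontier W := hcont.homeoOfEquivCompactToT2
  have hh (z : frontier V) : (h z : ℂ) = F z := rfl
  let γ' : ℝ → frontier W := fun t => ⟨γ t, hγm t⟩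
  have hγ' : Continuous γ' := hγ.subtype_mk _
  obtain ⟨n, m, hm, g, hg⟩ := exists_zpow_eq_zpow_mul_exp (σ := h.symm ∘ γ')
    (h.symm.continuous.comp hγ') (congrArg h.symm (Subtype.ext hγ1))
    (fun s hs t ht hst => hγi hs ht (congrArg Subtype.val (h.symm.injective hst)))
    (fun x => by
      obtain ⟨t, ht, e⟩ := hγW.ge (h x).2
      exact ⟨t, ht, (h.symm_apply_eq).2 (Subtype.ext e)⟩)
    ⟨fun z => (h z : ℂ) - w, by fun_prop⟩ ⟨fun z => (z : ℂ) - b, by fun_prop⟩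
    (fun z => sub_ne_zero.2 fun e => hwF ⟨z, hVf z.2, (hh z).symm.trans e⟩)
    (fun z => sub_ne_zero.2 fun e => z.2.2 (e ▸ hb))
    (by
      rintro ⟨g, hg⟩
      refine not_forall_frontier_eq_zpow_mul_exp hW hwi (f := fun _ => 1) continuousOn_const
        (fun _ _ => one_ne_zero) one_ne_zero (-(g.comp ⟨h.symm, h.symm.continuous⟩)) fun z => ?_
      have := hg (h.symm z)
      simp only [ContinuousMap.coe_mk, Homeomorph.apply_symm_apply] at this
      simp [this, ← Complex.exp_add])
    (by
      rintro ⟨g, hg⟩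
      refine not_forall_frontier_eq_zpow_mul_exp hV hb (f := fun _ => 1) continuousOn_const
        (fun _ _ => one_ne_zero) one_ne_zero (-g) fun z => ?_
      have := hg z
      simp only [ContinuousMap.coe_mk] at this
      simp [this, ← Complex.exp_add])
  have hFw : ∀ z ∈ V, F z - w ≠ 0 := fun z hz => sub_ne_zero.2 fun e => hwF ⟨z, hz, e⟩
  exact not_forall_frontier_eq_zpow_mul_exp hV hb (f := fun z => (F z - w) ^ n)
    ((hF.sub continuousOn_const).zpow₀ _ fun z hz => Or.inl (hFw z hz))
    (fun z hz => zpow_ne_zero _ (hFw z hz)) hm g hg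

/-- If `V` is the closure of a bounded simply connected open set, `W` is
compact with Jordan-curve boundary, `F : V → W` is continuous with `F(V) ⊆ W`, and the
restriction of `F` to `∂V` is a homeomorphism onto `∂W`, then `F` maps `V` onto `W`. -/
theorem boundary_homeo_implies_onto (V W : Set (ℝ × ℝ))
    (hV : IsClosureOfSCRegion V) (hWc : IsCompact W) (hJ : IsJordanCurve (frontier W))
    (F : ℝ × ℝ → ℝ × ℝ) (hF : ContinuousOn F V) (hFW : F '' V ⊆ W)
    (hinj : Set.InjOn F (frontier V)) (him : F '' frontier V = frontier W) :
    W ⊆ F '' V := by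
  obtain ⟨Ω, hΩo, hΩb, hΩne, -, rfl⟩ := hV
  obtain ⟨γ, hγ, hper, hγi, hγW⟩ := hJ
  have hγm (t : ℝ) : γ t ∈ frontier W := by
    obtain ⟨s, hs, e⟩ := Function.Periodic.exists_mem_Ico₀ hper one_pos t
    exact hγW ▸ ⟨s, hs, e.symm⟩
  let e : ℝ × ℝ ≃ₜ ℂ := Complex.equivRealProdCLM.symm.toHomeomorph
  have hee : (e ∘ F ∘ e.symm) ∘ e = e ∘ F := by ext; simp
  have key := subset_image_of_injOn_frontier (V := e '' closure Ω) (W := e '' W) (γ := e ∘ γ)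
    (F := e ∘ F ∘ e.symm) (hΩb.isCompact_closure.image e.continuous)
    (by
      rw [← e.image_interior]
      exact (hΩne.mono (interior_maximal subset_closure hΩo)).image e)
    (hWc.image e.continuous) (e.continuous.comp hγ)
    (congrArg e (by simpa using hper 0)) (e.injective.comp_injOn hγi)
    (by rw [image_comp, hγW, e.image_frontier])
    (fun t => e.image_frontier W ▸ mem_image_of_mem e (hγm t))
    (e.continuous.comp_continuousOn (hF.comp e.symm.continuous.continuousOn
      (by rintro _ ⟨x, hx, rfl⟩; simpa using hx)))
    (by
      rw [← e.image_frontier]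
      rintro _ ⟨x, hx, rfl⟩ _ ⟨y, hy, rfl⟩ hxy
      exact congrArg e (hinj hx hy (by simpa using hxy)))
    (by rw [← e.image_frontier, ← e.image_frontier, ← image_comp, hee, image_comp, him])
  rw [← image_comp, hee, image_comp] at key
  exact (image_subset_image_iff e.injective).1 key
end
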